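/- Let w be a permutation with w(i) > w(i−1) for all i ≤ 0 and let m ≥ 1. Then S_w · h_m = Σ S_{w·s_{c₁,d₁}⋯s_{c_m,d_m}}, where the sum is over all sequences of pairs of integers (c₁,d₁),…,(c_m,d_m) satisfying c_i > 0 ≥ d_i for each i, d₁ > d₂ > … > d_m, and ℓ(w·s_{c₁,d₁}⋯s_{c_{m′},d_{m′}}) = ℓ(w) + m′ for every m′ ≤ m (this sum has finitely many terms, and each permutation u appearing satisfies u(i) > u(i−1) for all i ≤ 0, so S_u ∈ ℤ[x₁,…,x_n]). -/

import Mathlib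

open scoped Classical

noncomputable section

namespace RCGraphs

/-- The simple transposition `s j`, interchanging `j` and `j+1`. -/
def sT (j : ℤ) : Equiv.Perm ℤ := Equiv.swap j (j + 1)

/-- The Coxeter length of a permutation of `ℤ`: the minimal length of an expression
as a product of simple transpositions. -/
def len (w : Equiv.Perm ℤ) : ℕ :=
  sInf {m : ℕ | ∃ l : List ℤ, l.length = m ∧ (l.map sT).prod = w}

/-- The permutations considered in the paper: bijections of `ℤ` fixing every `i > n`
and fixing all sufficiently small integers. -/
def IsPermZ (n : ℤ) (w : Equiv.Perm ℤ) : Prop :=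
  (∀ i : ℤ, n < i → w i = i) ∧ ∃ N : ℤ, ∀ i : ℤ, i < N → w i = i

/-- The reading order on positions `(i,k)`: rows (second coordinate) from `n` downward,
and within a row in order of increasing first coordinate. -/
def rcOrder (p q : ℤ × ℤ) : Prop :=
  q.2 < p.2 ∨ (p.2 = q.2 ∧ p.1 ≤ q.1)

instance : DecidableRel rcOrder := fun p q => by
  unfold rcOrder; infer_instance

instance : IsTrans (ℤ × ℤ) rcOrder :=
  ⟨fun a b c h₁ h₂ => by unfold rcOrder at *; omega⟩

instance : IsAntisymm (ℤ × ℤ) rcOrder :=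
  ⟨fun a b h₁ h₂ => by
    unfold rcOrder at *
    have h3 : a.1 = b.1 ∧ a.2 = b.2 := by omega
    exact Prod.ext h3.1 h3.2⟩

instance : IsTotal (ℤ × ℤ) rcOrder :=
  ⟨fun a b => by unfold rcOrder; omega⟩

/-- The permutation `w_R` associated to a finite set of positions `R`: the product of the
simple transpositions `s_{i+k-n-1}`, `(i,k) ∈ R`, in the reading order. -/
def wR (n : ℤ) (R : Finset (ℤ × ℤ)) : Equiv.Perm ℤ :=
  ((R.sort rcOrder).map fun p => sT (p.1 + p.2 - n - 1)).prod

/-- `R` is an rc-graph: positions lie in the grid `{(i,k) : i ≤ n, k ≤ n}` and the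
reading word is reduced. -/
def IsRC (n : ℤ) (R : Finset (ℤ × ℤ)) : Prop :=
  (∀ p ∈ R, p.1 ≤ n ∧ p.2 ≤ n) ∧ len (wR n R) = R.card

/-- Condition (*): `w_R(i) > w_R(i-1)` for all `i ≤ 0`; equivalently no two strands with
nonpositive labels cross. -/
def Star (n : ℤ) (R : Finset (ℤ × ℤ)) : Prop :=
  ∀ i : ℤ, i ≤ 0 → wR n R (i - 1) < wR n R i

/-- Strand labels in the wiring diagram of `R` (for diagrams all of whose crossings lie in
rows `k ≥ 1`, as is the case under condition (*)).  `lab n R true i k` is the label of the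
strand entering position `(i,k)` from the west (the strand passing above, if `(i,k)` is not
a crossing); `lab n R false i k` is the label of the strand entering from the south (the
strand passing below).  Each strand is labeled by the row where it begins. -/
def lab (n : ℤ) (R : Finset (ℤ × ℤ)) : Bool → ℤ → ℤ → ℤ
  | true, i, k =>
      if h : n ≤ i then k
      else if (i + 1, k) ∈ R then lab n R true (i + 1) k else lab n R false (i + 1) k
  | false, i, k =>
      if h : k ≤ 0 then i + k - n - 1
      else if (i, k - 1) ∈ R then lab n R false i (k - 1) else lab n R true i (k - 1)
  termination_by b i k => ((n - i).toNat + k.toNat)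
  decreasing_by
    all_goals simp_wf
    all_goals omega

/-- The label of the strand leaving position `(i,r)` northward. -/
def northLabel (n : ℤ) (R : Finset (ℤ × ℤ)) (i r : ℤ) : ℤ :=
  if (i, r) ∈ R then lab n R false i r else lab n R true i r

/-- `(i,k)` is an open space: not a crossing, the strand passing below it has a
nonpositive label and the strand passing above it has a positive label. -/
def OpenSpace (n : ℤ) (R : Finset (ℤ × ℤ)) (i k : ℤ) : Prop :=
  i ≤ n ∧ (i, k) ∉ R ∧ lab n R false i k ≤ 0 ∧ 0 < lab n R true i k

/-- The main loop of the Bergeron--Billey insertion algorithm, recording the trace: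
the list of pairs (current diagram, crossing just added).  `R` always contains the
crossing `p` that was just added. -/
def insertSteps (n : ℤ) : ℕ → Finset (ℤ × ℤ) → ℤ × ℤ → List (Finset (ℤ × ℤ) × (ℤ × ℤ))
  | 0, _, _ => []
  | fuel + 1, R, p =>
      (R, p) ::
        if IsRC n R then []
        else
          let a := lab n R true p.1 p.2
          let b := lab n R false p.1 p.2
          -- the unique other crossing of the two strands that cross at `p`
          let C := R.filter fun q =>
            q ≠ p ∧ ((lab n R true q.1 q.2 = a ∧ lab n R false q.1 q.2 = b) ∨
                     (lab n R true q.1 q.2 = b ∧ lab n R false q.1 q.2 = a))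
          let q := (C.sort rcOrder).headI
          let R' := R.erase q
          let i' := sInf {x : ℤ | q.1 < x ∧ OpenSpace n R' x q.2}
          insertSteps n fuel (insert (i', q.2) R') (i', q.2)

/-- The trace of the insertion of `k` into `R`: the states of the algorithm together with
the crossings added at each step. -/
def insertStepsOf (n : ℤ) (R : Finset (ℤ × ℤ)) (k : ℤ) : List (Finset (ℤ × ℤ) × (ℤ × ℤ)) :=
  let i₁ := sInf {x : ℤ | OpenSpace n R x k}
  insertSteps n ((n + 1 - k).toNat + 1) (insert (i₁, k) R) (i₁, k)

/-- The insertion `R ← k` of Bergeron and Billey. -/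
def insertOne (n : ℤ) (R : Finset (ℤ × ℤ)) (k : ℤ) : Finset (ℤ × ℤ) :=
  ((insertStepsOf n R k).getLast?.getD (R, (0, 0))).1

/-- The insertion `R ← v` of a word. -/
def insertWord (n : ℤ) (R : Finset (ℤ × ℤ)) (v : List ℕ) : Finset (ℤ × ℤ) :=
  v.foldl (fun S a => insertOne n S (a : ℤ)) R

/-- The column (first coordinate) at which the strand labeled `a` of the diagram `R`
leaves row `r` northward. -/
def strandCol (n : ℤ) (R : Finset (ℤ × ℤ)) (a r : ℤ) : ℤ :=
  sSup {i : ℤ | i ≤ n ∧ northLabel n R i r = a}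

/-- Given the trace `L` of an insertion, the column occupied in row `r` by the left path
(`left = true`) or the right path (`left = false`) of the insertion.  Between the rows of
the `t`-th and `(t+1)`-st added crossings, the left path is the piece `s_t` of the strand
whose label changes from `a_t` to `b_t`, and the right path is the piece `s^t` whose label
changes from `b_t` to `a_t`. -/
def pathCol (n : ℤ) (L : List (Finset (ℤ × ℤ) × (ℤ × ℤ))) (left : Bool) (r : ℤ) : ℤ :=
  match (L.filter fun e => e.2.2 ≤ r).getLast? with
  | some e => strandCol n e.1 (lab n e.1 left e.2.1 e.2.2) r
  | none => 0

/-- A semistandard Young tableau with at most `n` rows (rows indexed `1,…,n`, row `j`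
having `μ j` boxes, columns indexed from `0`), with entries in `{1,…,n}`, weakly
increasing along rows and strictly increasing down columns; entries outside the shape
are `0`. -/
structure SSYT (n : ℕ) (μ : ℕ → ℕ) where
  entry : ℕ → ℕ → ℕ
  entry_mem : ∀ j c, 1 ≤ j → j ≤ n → c < μ j → 1 ≤ entry j c ∧ entry j c ≤ n
  row_weak : ∀ j c₁ c₂, 1 ≤ j → j ≤ n → c₁ ≤ c₂ → c₂ < μ j → entry j c₁ ≤ entry j c₂
  col_strict : ∀ j₁ j₂ c, 1 ≤ j₁ → j₁ < j₂ → j₂ ≤ n → c < μ j₂ → entry j₁ c < entry j₂ c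
  outside : ∀ j c, j = 0 ∨ n < j ∨ μ j ≤ c → entry j c = 0

/-- `μ` is a partition with (at most) `n` parts `μ 1 ≥ μ 2 ≥ … ≥ μ n ≥ 0`
(and `μ j = 0` outside `1,…,n`). -/
def IsPartition (n : ℕ) (μ : ℕ → ℕ) : Prop :=
  (∀ j, 1 ≤ j → j < n → μ (j + 1) ≤ μ j) ∧ ∀ j, j = 0 ∨ n < j → μ j = 0

/-- The reading word of a tableau: the rows read left to right, from the bottom row
to the top one. -/
def readingWord (n : ℕ) (μ : ℕ → ℕ) (Y : SSYT n μ) : List ℕ :=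
  ((List.range n).reverse.map (· + 1)).flatMap fun j =>
    (List.range (μ j)).map fun c => Y.entry j c

/-- An elementary Knuth move. -/
def KnuthMove (w₁ w₂ : List ℕ) : Prop :=
  (∃ (u v : List ℕ) (x y z : ℕ), x < y ∧ y ≤ z ∧
      w₁ = u ++ y :: x :: z :: v ∧ w₂ = u ++ y :: z :: x :: v) ∨
  (∃ (u v : List ℕ) (x y z : ℕ), x ≤ y ∧ y < z ∧
      w₁ = u ++ x :: z :: y :: v ∧ w₂ = u ++ z :: x :: y :: v)

/-- Knuth equivalence: the equivalence relation generated by elementary Knuth moves. -/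
def KnuthEquiv (w₁ w₂ : List ℕ) : Prop := Relation.EqvGen KnuthMove w₁ w₂

/-- The monomial `x^R = ∏_{(i,k) ∈ R} x_k`. -/
def xR (R : Finset (ℤ × ℤ)) : MvPolynomial ℕ ℤ :=
  ∏ p ∈ R, MvPolynomial.X p.2.toNat

/-- The monomial `x^Y = ∏ x_i`, one factor for each entry `i` of `Y`. -/
def xY (n : ℕ) (μ : ℕ → ℕ) (Y : SSYT n μ) : MvPolynomial ℕ ℤ :=
  ((readingWord n μ Y).map MvPolynomial.X).prod

/-- The Schubert polynomial `S_w = Σ_{R : w_R = w} x^R`. -/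
def Schub (n : ℤ) (w : Equiv.Perm ℤ) : MvPolynomial ℕ ℤ :=
  ∑ᶠ R ∈ {R : Finset (ℤ × ℤ) | IsRC n R ∧ wR n R = w}, xR R

/-- The Schur polynomial `s_μ(x₁,…,x_n) = Σ_Y x^Y`, summing over all semistandard Young
tableaux of shape `μ` with entries in `{1,…,n}`. -/
def SchurP (n : ℕ) (μ : ℕ → ℕ) : MvPolynomial ℕ ℤ :=
  ∑ᶠ Y : SSYT n μ, xY n μ Y

/-- The complete homogeneous symmetric polynomial
`h_m = Σ_{1 ≤ i₁ ≤ … ≤ i_m ≤ n} x_{i₁} ⋯ x_{i_m}`. -/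
def hPoly (n m : ℕ) : MvPolynomial ℕ ℤ :=
  ∑ s ∈ (Finset.Icc 1 n).sym m, (s.1.map MvPolynomial.X).prod

/-- The top rc-graph `R(μ) = {(i,k) : 1 ≤ k ≤ n, n - μ_k + 1 ≤ i ≤ n}` of a partition. -/
def Rmu (n : ℕ) (μ : ℕ → ℕ) : Finset (ℤ × ℤ) :=
  (Finset.Icc 1 (n : ℤ)).biUnion fun k =>
    (Finset.Icc ((n : ℤ) - μ k.toNat + 1) (n : ℤ)).image fun i => (i, k)


/-! ### Inversions and length -/

def Inv (w : Equiv.Perm ℤ) : Set (ℤ × ℤ) := {p | p.1 < p.2 ∧ w p.2 < w p.1}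

def FS (w : Equiv.Perm ℤ) : Prop := ∃ lo hi : ℤ, ∀ i : ℤ, (i < lo ∨ hi < i) → w i = i

def Cov (w : Equiv.Perm ℤ) (d c : ℤ) : Prop :=
  d < c ∧ w d < w c ∧ ∀ e, d < e → e < c → ¬ (w d < w e ∧ w e < w c)

theorem FS.one : FS 1 := ⟨0, 0, fun _ _ => rfl⟩

theorem FS.swap_mul {w : Equiv.Perm ℤ} (h : FS w) (a b : ℤ) : FS (Equiv.swap a b * w) := by
  obtain ⟨lo, hi, h⟩ := h
  refine ⟨min lo (min a b), max hi (max a b), fun i hi' => ?_⟩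
  have : w i = i := h i (by omega)
  rw [Equiv.Perm.mul_apply, this, Equiv.swap_apply_of_ne_of_ne] <;> omega

theorem FS.mul_swap {w : Equiv.Perm ℤ} (h : FS w) (a b : ℤ) : FS (w * Equiv.swap a b) := by
  obtain ⟨lo, hi, h⟩ := h
  refine ⟨min lo (min a b), max hi (max a b), fun i hi' => ?_⟩
  have : w i = i := h i (by omega)
  rw [Equiv.Perm.mul_apply, Equiv.swap_apply_of_ne_of_ne, this] <;> omega

theorem FS.inv_finite {w : Equiv.Perm ℤ} (h : FS w) : (Inv w).Finite := by
  obtain ⟨lo, hi, h⟩ := h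
  refine Set.Finite.subset (Set.finite_Icc ((lo, lo) : ℤ × ℤ) (hi, hi)) ?_
  rintro ⟨a, b⟩ ⟨h1, h2⟩
  simp only at h1 h2
  have key : lo ≤ a ∧ b ≤ hi := by
    constructor
    · by_contra hc
      have ha : w a = a := h a (by omega)
      have hb : w (w b) = w b := h (w b) (by omega)
      have := w.injective hb
      omega
    · by_contra hc
      have hb : w b = b := h b (by omega)
      have ha : w (w a) = w a := h (w a) (by omega)
      have := w.injective ha
      omega
  exact ⟨⟨key.1, by simp only; omega⟩, ⟨by simp only; omega, key.2⟩⟩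

def psi (d c : ℤ) (p : ℤ × ℤ) : ℤ × ℤ :=
  if Equiv.swap c d p.1 < Equiv.swap c d p.2 then (Equiv.swap c d p.1, Equiv.swap c d p.2) else p

theorem swap_app (c d a : ℤ) : Equiv.swap c d a = if a = c then d else if a = d then c else a :=
  Equiv.swap_apply_def c d a

theorem psi_mapsTo {w : Equiv.Perm ℤ} {d c : ℤ} (hdc : d < c) (hw : w d < w c) :
    Set.MapsTo (psi d c) (Inv w) (Inv (w * Equiv.swap c d) \ {(d, c)}) := by
  rintro ⟨a, b⟩ ⟨h1, h2⟩
  simp only at h1 h2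
  unfold psi
  split_ifs with h
  · refine ⟨⟨h, by simpa using h2⟩, ?_⟩
    simp only [Set.mem_singleton_iff, Prod.mk.injEq, not_and]
    intro h3 h4
    rw [swap_app] at h3 h4
    split_ifs at h3 h4 <;> omega
  · simp only [swap_app] at h
    refine ⟨⟨h1, ?_⟩, ?_⟩
    · simp only [Equiv.Perm.mul_apply, swap_app]
      grind
    · simp only [Set.mem_singleton_iff, Prod.mk.injEq, not_and]
      rintro rfl rfl
      omega

theorem psi_injOn {w : Equiv.Perm ℤ} {d c : ℤ} (hdc : d < c) (hw : w d < w c) :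
    Set.InjOn (psi d c) (Inv w) := by
  rintro ⟨a, b⟩ ⟨h1, h2⟩ ⟨a', b'⟩ ⟨h1', h2'⟩ heq
  simp only at h1 h2 h1' h2'
  simp only [psi, swap_app] at heq
  grind

theorem psi_surjOn {w : Equiv.Perm ℤ} {d c : ℤ} (hc : Cov w d c) :
    Set.SurjOn (psi d c) (Inv w) (Inv (w * Equiv.swap c d) \ {(d, c)}) := by
  obtain ⟨hdc, hw, hb⟩ := hc
  rintro ⟨a, b⟩ ⟨⟨h1, h2⟩, h3⟩
  simp only [Equiv.Perm.mul_apply] at h1 h2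
  simp only [Set.mem_singleton_iff, Prod.mk.injEq, not_and] at h3
  by_cases h : Equiv.swap c d a < Equiv.swap c d b
  · refine ⟨(Equiv.swap c d a, Equiv.swap c d b), ⟨h, h2⟩, ?_⟩
    simp [psi, h1]
  · refine ⟨(a, b), ⟨h1, ?_⟩, ?_⟩
    · have hb1 := hb a
      have hb2 := hb b
      have hi1 := w.injective.ne_iff (x := a) (y := c)
      have hi2 := w.injective.ne_iff (x := b) (y := d)
      simp only [swap_app] at h h2
      simp only
      grind
    · simp [psi, h]

theorem inv_lt {w : Equiv.Perm ℤ} (hf : FS w) {d c : ℤ} (hdc : d < c) (hw : w d < w c) :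
    (Inv w).ncard + 1 ≤ (Inv (w * Equiv.swap c d)).ncard := by
  have hfin := (hf.mul_swap c d).inv_finite
  have hm : (d, c) ∈ Inv (w * Equiv.swap c d) := by
    refine ⟨hdc, ?_⟩
    simpa using hw
  rw [← Set.ncard_sdiff_singleton_add_one hm hfin]
  exact Nat.add_le_add_right (Set.ncard_le_ncard_of_injOn _ (psi_mapsTo hdc hw)
    (psi_injOn hdc hw) (hfin.subset Set.sdiff_subset)) 1

theorem inv_cov {w : Equiv.Perm ℤ} (hf : FS w) {d c : ℤ} (hc : Cov w d c) :
    (Inv (w * Equiv.swap c d)).ncard = (Inv w).ncard + 1 := by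
  have hfin := (hf.mul_swap c d).inv_finite
  have hm : (d, c) ∈ Inv (w * Equiv.swap c d) := by
    refine ⟨hc.1, ?_⟩
    simpa using hc.2.1
  rw [← Set.ncard_sdiff_singleton_add_one hm hfin]
  congr 1
  have : psi d c '' Inv w = Inv (w * Equiv.swap c d) \ {(d, c)} :=
    (Set.BijOn.mk (psi_mapsTo hc.1 hc.2.1) (psi_injOn hc.1 hc.2.1) (psi_surjOn hc)).image_eq
  rw [← this, (psi_injOn hc.1 hc.2.1).ncard_image]

/-- left multiplication by `sT j` as right multiplication by a swap of positions -/
theorem sT_mul_eq (w : Equiv.Perm ℤ) (j : ℤ) :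
    sT j * w = w * Equiv.swap (w⁻¹ j) (w⁻¹ (j + 1)) := by
  rw [sT, Equiv.mul_swap_eq_swap_mul]; simp

theorem inv_sT_up {w : Equiv.Perm ℤ} (hf : FS w) {j : ℤ} (h : w⁻¹ j < w⁻¹ (j + 1)) :
    (Inv (sT j * w)).ncard = (Inv w).ncard + 1 := by
  rw [sT_mul_eq, Equiv.swap_comm]
  apply inv_cov hf
  refine ⟨h, by simp, fun e _ _ => ?_⟩
  simp

theorem sT_sT (j : ℤ) (w : Equiv.Perm ℤ) : sT j * (sT j * w) = w := by
  rw [← mul_assoc, sT, Equiv.swap_mul_self, one_mul]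

theorem sT_inv_l (j : ℤ) (w : Equiv.Perm ℤ) : (sT j * w)⁻¹ j = w⁻¹ (j + 1) := by
  simp [sT, mul_inv_rev]

theorem sT_inv_r (j : ℤ) (w : Equiv.Perm ℤ) : (sT j * w)⁻¹ (j + 1) = w⁻¹ j := by
  simp [sT, mul_inv_rev]

theorem inv_sT_down {w : Equiv.Perm ℤ} (hf : FS w) {j : ℤ} (h : w⁻¹ (j + 1) < w⁻¹ j) :
    (Inv w).ncard = (Inv (sT j * w)).ncard + 1 := by
  have := inv_sT_up (w := sT j * w) (j := j) (hf.swap_mul _ _) (by rw [sT_inv_l, sT_inv_r]; exact h)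
  rwa [sT_sT] at this

theorem mono_id {w : Equiv.Perm ℤ} (hf : FS w) (h : ∀ j : ℤ, w⁻¹ j < w⁻¹ (j + 1)) : w = 1 := by
  obtain ⟨lo, hi, hf⟩ := hf
  have hlo : ∀ i < lo, w⁻¹ i = i := fun i hi' => by
    rw [Equiv.Perm.inv_eq_iff_eq]; exact (hf i (Or.inl hi')).symm
  have hhi : ∀ i > hi, w⁻¹ i = i := fun i hi' => by
    rw [Equiv.Perm.inv_eq_iff_eq]; exact (hf i (Or.inr hi')).symm
  have a1 : ∀ k : ℕ, ∀ i, i < lo + k → i ≤ w⁻¹ i := by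
    intro k
    induction k with
    | zero => intro i hi'; rw [hlo i (by simpa using hi')]
    | succ k ih =>
      intro i hi'
      have := ih (i - 1) (by push_cast at hi'; omega)
      have h2 := h (i - 1)
      simp only [sub_add_cancel] at h2
      omega
  have a2 : ∀ k : ℕ, ∀ i, hi - k < i → w⁻¹ i ≤ i := by
    intro k
    induction k with
    | zero => intro i hi'; rw [hhi i (by simpa using hi')]
    | succ k ih =>
      intro i hi'
      have := ih (i + 1) (by push_cast at hi'; omega)
      have h2 := h i
      omega
  ext i
  have e1 := a1 (i - lo + 1).toNat i (by omega)
  have e2 := a2 (hi - i + 1).toNat i (by omega)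
  have e3 : w⁻¹ i = i := by omega
  rw [Equiv.Perm.inv_eq_iff_eq] at e3
  simpa using e3.symm

theorem prod_FS (l : List ℤ) : FS (l.map sT).prod ∧ (Inv (l.map sT).prod).ncard ≤ l.length := by
  induction l with
  | nil =>
    refine ⟨FS.one, ?_⟩
    have : Inv (1 : Equiv.Perm ℤ) = ∅ := by
      ext p; simp [Inv]; omega
    simp [this]
  | cons j l ih =>
    simp only [List.map_cons, List.prod_cons, List.length_cons]
    refine ⟨ih.1.swap_mul _ _, ?_⟩
    rcases lt_trichotomy ((l.map sT).prod⁻¹ j) ((l.map sT).prod⁻¹ (j + 1)) with h | h | h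
    · rw [inv_sT_up ih.1 h]; have := ih.2; omega
    · have := (Equiv.injective _) h; omega
    · have := inv_sT_down ih.1 h; have := ih.2; omega

theorem exists_word (k : ℕ) : ∀ w : Equiv.Perm ℤ, FS w → (Inv w).ncard = k →
    ∃ l : List ℤ, l.length = k ∧ (l.map sT).prod = w := by
  induction k with
  | zero =>
    intro w hf h0
    refine ⟨[], rfl, ?_⟩
    symm
    simp only [List.map_nil, List.prod_nil]
    apply mono_id hf
    intro j
    by_contra hc
    have hne : w⁻¹ j ≠ w⁻¹ (j + 1) := fun h => by have := (Equiv.injective _) h; omega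
    have := inv_sT_down hf (j := j) (by omega)
    omega
  | succ k ih =>
    intro w hf hk
    have : ∃ j, w⁻¹ (j + 1) < w⁻¹ j := by
      by_contra hc
      push Not at hc
      have : w = 1 := mono_id hf fun j => lt_of_le_of_ne (hc j) fun h => by
        have := (Equiv.injective _) h; omega
      subst this
      have : Inv (1 : Equiv.Perm ℤ) = ∅ := by
        ext p; simp [Inv]; omega
      simp [this] at hk
    obtain ⟨j, hj⟩ := this
    obtain ⟨l, h1, h2⟩ := ih (sT j * w) (hf.swap_mul _ _) (by have := inv_sT_down hf hj; omega)
    exact ⟨j :: l, by simp [h1], by simp [h2, sT_sT]⟩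

theorem len_eq {w : Equiv.Perm ℤ} (hf : FS w) : len w = (Inv w).ncard := by
  apply le_antisymm
  · exact Nat.sInf_le (exists_word _ w hf rfl)
  · have hne : {m : ℕ | ∃ l : List ℤ, l.length = m ∧ (l.map sT).prod = w}.Nonempty :=
      ⟨_, exists_word _ w hf rfl⟩
    obtain ⟨l, h1, h2⟩ := Nat.sInf_mem hne
    rw [len, ← h1]
    conv_lhs => rw [← h2]
    exact (prod_FS l).2

theorem len_cov {w : Equiv.Perm ℤ} (hf : FS w) {d c : ℤ} (hdc : d < c) :
    len (w * Equiv.swap c d) = len w + 1 ↔ Cov w d c := by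
  rw [len_eq hf, len_eq (hf.mul_swap c d)]
  constructor
  · intro h
    have h1 : w d < w c := by
      by_contra hc
      have hne : w d ≠ w c := fun h => by have := w.injective h; omega
      have := inv_lt (w := w * Equiv.swap c d) (hf.mul_swap c d) hdc (by simp; omega)
      rw [mul_assoc, Equiv.swap_mul_self, mul_one] at this
      omega
    refine ⟨hdc, h1, ?_⟩
    rintro e he1 he2 ⟨h3, h4⟩
    have s1 := inv_lt hf he1 h3
    have s2 := inv_lt (w := w * Equiv.swap e d) (hf.mul_swap _ _) hdc (by
      rw [Equiv.Perm.mul_apply, Equiv.Perm.mul_apply, Equiv.swap_apply_right,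
        Equiv.swap_apply_of_ne_of_ne] <;> omega)
    have s3 := inv_lt (w := w * Equiv.swap e d * Equiv.swap c d)
      ((hf.mul_swap _ _).mul_swap _ _) he2 (by
      simp only [Equiv.Perm.mul_apply, swap_app]
      grind)
    have : w * Equiv.swap e d * Equiv.swap c d * Equiv.swap c e = w * Equiv.swap c d := by
      ext i
      simp only [Equiv.Perm.mul_apply, swap_app]
      grind
    rw [this] at s3
    omega
  · intro h
    exact inv_cov hf h

theorem len_sT {w : Equiv.Perm ℤ} (hf : FS w) (j : ℤ) :
    (w⁻¹ (j + 1) < w⁻¹ j ∧ len w = len (sT j * w) + 1) ∨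
    (w⁻¹ j < w⁻¹ (j + 1) ∧ len (sT j * w) = len w + 1) := by
  have hs : FS (sT j * w) := hf.swap_mul _ _
  rw [len_eq hf, len_eq hs]
  rcases lt_trichotomy (w⁻¹ j) (w⁻¹ (j + 1)) with h | h | h
  · exact Or.inr ⟨h, inv_sT_up hf h⟩
  · have := (Equiv.injective _) h; omega
  · exact Or.inl ⟨h, inv_sT_down hf h⟩

theorem w_winv (w : Equiv.Perm ℤ) (a : ℤ) : w (w⁻¹ a) = a := w.apply_symm_apply a

/-! ### The operators -/

structure Gd (C : ℤ) (w : Equiv.Perm ℤ) : Prop where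
  mono : ∀ i : ℤ, i ≤ 0 → w (i - 1) < w i
  hi : ∀ i : ℤ, C < i → w i = i

theorem Gd.lt {C : ℤ} {w : Equiv.Perm ℤ} (h : Gd C w) {a b : ℤ} (hab : a < b) (hb : b ≤ 0) :
    w a < w b := by
  have key : ∀ k : ℕ, w (b - (k + 1 : ℕ)) < w b := by
    intro k
    induction k with
    | zero => simpa using h.mono b hb
    | succ k ih =>
      have := h.mono (b - (k + 1 : ℕ)) (by omega)
      have e : b - ((k + 1 + 1 : ℕ) : ℤ) = b - (k + 1 : ℕ) - 1 := by push_cast; ring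
      rw [e]; omega
  have := key (b - a - 1).toNat
  have e : b - (((b - a - 1).toNat + 1 : ℕ) : ℤ) = a := by omega
  rwa [e] at this

theorem Gd.cov {C : ℤ} {w : Equiv.Perm ℤ} (h : Gd C w) {d c : ℤ} (hc : Cov w d c) (hd : d ≤ 0)
    (hc0 : 0 < c) (hcC : c ≤ C) : Gd C (w * Equiv.swap c d) := by
  obtain ⟨h1, h2, h3⟩ := hc
  constructor
  · intro i hi
    simp only [Equiv.Perm.mul_apply, swap_app]
    have m1 := h.mono i hi
    by_cases hi1 : i - 1 = d
    · have := h3 i (by omega) (by omega)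
      have hne : w i ≠ w c := fun he => by have := w.injective he; omega
      rw [if_neg (by omega), if_pos hi1, if_neg (by omega), if_neg (by omega)]
      subst hi1
      omega
    · rw [if_neg (by omega), if_neg hi1, if_neg (by omega)]
      split_ifs with hi2
      · subst hi2; omega
      · exact m1
  · intro i hi
    rw [Equiv.Perm.mul_apply, Equiv.swap_apply_of_ne_of_ne (by omega) (by omega), h.hi i hi]

theorem sT_app (j a : ℤ) : sT j a = if a = j then j + 1 else if a = j + 1 then j else a :=
  Equiv.swap_apply_def j (j + 1) a

theorem Gd.desc {C : ℤ} {w : Equiv.Perm ℤ} (h : Gd C w) {j : ℤ} (hj : w⁻¹ (j + 1) < w⁻¹ j)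
    (hjC : j < C) : Gd C (sT j * w) := by
  constructor
  · intro i hi
    have m1 := h.mono i hi
    have hne : ¬ (w (i - 1) = j ∧ w i = j + 1) := by
      rintro ⟨e1, e2⟩
      rw [← e2, ← e1] at hj
      simp at hj
      omega
    simp only [Equiv.Perm.mul_apply, sT_app]
    split_ifs <;> omega
  · intro i hi
    rw [Equiv.Perm.mul_apply, h.hi i hi, sT_app, if_neg (by omega), if_neg (by omega)]

theorem lo_desc {N : ℤ} {w : Equiv.Perm ℤ} (h : ∀ i < N, w i = i) {j : ℤ}
    (hj : w⁻¹ (j + 1) < w⁻¹ j) : N ≤ j ∧ ∀ i < N, (sT j * w) i = i := by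
  have hN : N ≤ j := by
    by_contra hc
    have h1 : w⁻¹ j = j := by rw [Equiv.Perm.inv_eq_iff_eq]; exact (h j (by omega)).symm
    have h2 := h (w⁻¹ (j + 1)) (by omega)
    rw [w_winv] at h2
    omega
  refine ⟨hN, fun i hi => ?_⟩
  rw [Equiv.Perm.mul_apply, h i hi, sT_app, if_neg (by omega), if_neg (by omega)]

theorem lo_swap {N : ℤ} {w : Equiv.Perm ℤ} (h : ∀ i < N, w i = i) {d c : ℤ} (hd : N ≤ d)
    (hc : N ≤ c) : ∀ i < N, (w * Equiv.swap c d) i = i := by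
  intro i hi
  rw [Equiv.Perm.mul_apply, Equiv.swap_apply_of_ne_of_ne (by omega) (by omega), h i hi]

theorem inv_swap_app (w : Equiv.Perm ℤ) (c d a : ℤ) :
    (w * Equiv.swap c d)⁻¹ a = Equiv.swap c d (w⁻¹ a) := by
  simp [mul_inv_rev]

theorem comm_logic (w : Equiv.Perm ℤ) {d c j : ℤ} (hdc : d < c)
    (h1 : ¬ (w d = j ∧ w c = j + 1)) (h2 : ¬ (w d = j + 1 ∧ w c = j)) :
    (Cov w d c ∧ (w * Equiv.swap c d)⁻¹ (j + 1) < (w * Equiv.swap c d)⁻¹ j) ↔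
    (w⁻¹ (j + 1) < w⁻¹ j ∧ Cov (sT j * w) d c) := by
  obtain ⟨p, hp⟩ := w.surjective j
  obtain ⟨q, hq⟩ := w.surjective (j + 1)
  have ep : w⁻¹ j = p := by rw [Equiv.Perm.inv_eq_iff_eq]; exact hp.symm
  have eq : w⁻¹ (j + 1) = q := by rw [Equiv.Perm.inv_eq_iff_eq]; exact hq.symm
  rw [inv_swap_app, inv_swap_app, ep, eq, swap_app, swap_app]
  have ip : ∀ a, w a = j ↔ a = p := fun a => by rw [← hp]; exact w.injective.eq_iff
  have iq : ∀ a, w a = j + 1 ↔ a = q := fun a => by rw [← hq]; exact w.injective.eq_iff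
  have hpq : p ≠ q := by rintro rfl; omega
  simp only [ip, iq] at h1 h2
  unfold Cov
  simp only [Equiv.Perm.mul_apply, sT_app, ip, iq]
  constructor
  · rintro ⟨⟨_, a2, a3⟩, a4⟩
    have a3p := a3 p
    have a3q := a3 q
    rw [hp] at a3p
    rw [hq] at a3q
    have dp := ip d
    have dq := iq d
    have cp := ip c
    have cq := iq c
    have hlt : q < p := by grind
    refine ⟨hlt, hdc, by grind, ?_⟩
    intro e he1 he2 he3
    have := a3 e he1 he2
    have := ip e
    have := iq e
    grind
  · rintro ⟨b1, _, b2, b3⟩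
    have dp := ip d
    have dq := iq d
    have cp := ip c
    have cq := iq c
    have b3p := b3 p
    have b3q := b3 q
    refine ⟨⟨hdc, by grind, ?_⟩, by grind⟩
    intro e he1 he2 he3
    have := b3 e he1 he2
    have := ip e
    have := iq e
    grind

variable {A : Type*} [CommRing A]

def Top (C d : ℤ) (f : Equiv.Perm ℤ → A) (w : Equiv.Perm ℤ) : A :=
  ∑ c ∈ Finset.Icc 1 C, if Cov w d c then f (w * Equiv.swap c d) else 0

def Dop (j : ℤ) (f : Equiv.Perm ℤ → A) (w : Equiv.Perm ℤ) : A :=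
  if w⁻¹ (j + 1) < w⁻¹ j then f (sT j * w) else 0

theorem comm_term (w : Equiv.Perm ℤ) {d c j : ℤ} (hdc : d < c) (g : Equiv.Perm ℤ → A) :
    (if Cov w d c then Dop j g (w * Equiv.swap c d) else 0) =
      (if w⁻¹ (j + 1) < w⁻¹ j then
        (if Cov (sT j * w) d c then g (sT j * w * Equiv.swap c d) else 0) else 0)
      + ((if w d = j ∧ w c = j + 1 then 1 else 0) - (if w d = j + 1 ∧ w c = j then 1 else 0))
        * g w := by
  by_cases h1 : w d = j ∧ w c = j + 1
  · have e1 : w⁻¹ j = d := by rw [Equiv.Perm.inv_eq_iff_eq]; exact h1.1.symm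
    have e2 : w⁻¹ (j + 1) = c := by rw [Equiv.Perm.inv_eq_iff_eq]; exact h1.2.symm
    have hcov : Cov w d c := ⟨hdc, by omega, fun e _ _ => by omega⟩
    have e3 : sT j * (w * Equiv.swap c d) = w := by
      rw [← mul_assoc, sT_mul_eq, e1, e2, Equiv.swap_comm, mul_assoc, Equiv.swap_mul_self, mul_one]
    have h2 : ¬ (w d = j + 1 ∧ w c = j) := by omega
    rw [if_pos hcov, Dop, inv_swap_app, inv_swap_app, e1, e2, e3, if_pos h1, if_neg h2,
      if_pos (by simpa using hdc), if_neg (by omega)]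
    ring
  · by_cases h2 : w d = j + 1 ∧ w c = j
    · have e1 : w⁻¹ j = c := by rw [Equiv.Perm.inv_eq_iff_eq]; exact h2.2.symm
      have e2 : w⁻¹ (j + 1) = d := by rw [Equiv.Perm.inv_eq_iff_eq]; exact h2.1.symm
      have hcov : ¬ Cov w d c := fun h => by have := h.2.1; omega
      have hcov2 : Cov (sT j * w) d c := by
        refine ⟨hdc, ?_, fun e _ _ => ?_⟩
        · simp only [Equiv.Perm.mul_apply, h2.1, h2.2, sT_app]; simp
        · simp only [Equiv.Perm.mul_apply, h2.1, h2.2, sT_app]; simp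
      have e3 : sT j * w * Equiv.swap c d = w := by
        rw [sT_mul_eq, e1, e2, mul_assoc, Equiv.swap_mul_self, mul_one]
      rw [if_neg hcov, if_neg h1, if_pos h2, e1, e2, if_pos hdc, if_pos hcov2, e3]
      ring
    · have := comm_logic w hdc h1 h2
      rw [if_neg h1, if_neg h2, sub_zero, zero_mul, add_zero, Dop, mul_assoc, ← ite_and, ← ite_and]
      simp only [this]

def eps (w : Equiv.Perm ℤ) (d j : ℤ) : A :=
  (if w d = j ∧ 0 < w⁻¹ (j + 1) then 1 else 0) - (if w d = j + 1 ∧ 0 < w⁻¹ j then 1 else 0)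

theorem sum_eps {C : ℤ} {w : Equiv.Perm ℤ} (h : Gd C w) (b b' : ℤ) {a : ℤ} (ha : a ≤ C) :
    (∑ c ∈ Finset.Icc 1 C, if b = b' ∧ w c = a then (1 : A) else 0)
      = if b = b' ∧ 0 < w⁻¹ a then 1 else 0 := by
  by_cases hP : b = b'
  · simp only [hP, true_and]
    have e : ∀ c, w c = a ↔ w⁻¹ a = c := fun c => by
      rw [Equiv.Perm.inv_eq_iff_eq]; exact eq_comm
    simp only [e]
    rw [Finset.sum_ite_eq]
    have : w⁻¹ a ≤ C := by
      by_contra hc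
      have := h.hi (w⁻¹ a) (by omega)
      rw [w_winv] at this
      omega
    have e2 : w⁻¹ a ∈ Finset.Icc 1 C ↔ 0 < w⁻¹ a := by
      rw [Finset.mem_Icc]; omega
    simp only [e2]
  · simp [hP]

theorem comm_TD {C : ℤ} {w : Equiv.Perm ℤ} (h : Gd C w) {d j : ℤ} (hd : d ≤ 0) (hj : j < C)
    (g : Equiv.Perm ℤ → A) :
    Top C d (Dop j g) w = Dop j (Top C d g) w + eps w d j * g w := by
  unfold Top
  have : ∀ c ∈ Finset.Icc 1 C, _ := fun c hc =>
    comm_term (A := A) w (d := d) (c := c) (j := j) (by rw [Finset.mem_Icc] at hc; omega) g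
  rw [Finset.sum_congr rfl this, Finset.sum_add_distrib, ← Finset.sum_mul, Finset.sum_sub_distrib,
    sum_eps h _ _ (by omega), sum_eps h _ _ (by omega)]
  unfold Dop eps
  congr 1
  split_ifs with hh
  · rfl
  · simp

theorem Top_congr {C d : ℤ} {f g : Equiv.Perm ℤ → A} {w : Equiv.Perm ℤ}
    (h : ∀ c, 1 ≤ c → c ≤ C → Cov w d c → f (w * Equiv.swap c d) = g (w * Equiv.swap c d)) :
    Top C d f w = Top C d g w := by
  unfold Top
  refine Finset.sum_congr rfl fun c hc => ?_
  rw [Finset.mem_Icc] at hc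
  split_ifs with hh
  · exact h c hc.1 hc.2 hh
  · rfl

theorem Top_zero {C d : ℤ} {f : Equiv.Perm ℤ → A} {w : Equiv.Perm ℤ}
    (h : ∀ c, 1 ≤ c → c ≤ C → Cov w d c → f (w * Equiv.swap c d) = 0) :
    Top C d f w = 0 := by
  unfold Top
  refine Finset.sum_eq_zero fun c hc => ?_
  rw [Finset.mem_Icc] at hc
  split_ifs with hh
  · exact h c hc.1 hc.2 hh
  · rfl

theorem Top_add (C d : ℤ) (f g : Equiv.Perm ℤ → A) (w : Equiv.Perm ℤ) :
    Top C d (fun v => f v + g v) w = Top C d f w + Top C d g w := by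
  unfold Top
  rw [← Finset.sum_add_distrib]
  refine Finset.sum_congr rfl fun c _ => ?_
  split_ifs <;> simp

theorem Top_mul (C d : ℤ) (a : A) (f : Equiv.Perm ℤ → A) (w : Equiv.Perm ℤ) :
    Top C d (fun v => a * f v) w = a * Top C d f w := by
  unfold Top
  rw [Finset.mul_sum]
  refine Finset.sum_congr rfl fun c _ => ?_
  split_ifs <;> simp

def Uop (t y : A) (C j d : ℤ) (f : Equiv.Perm ℤ → A) (w : Equiv.Perm ℤ) : A :=
  (1 - if w d = j then y else 0) * f w + t * Top C d f w

def Zop (t y : A) (C j : ℤ) : ℤ → ℕ → (Equiv.Perm ℤ → A) → Equiv.Perm ℤ → A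
  | _, 0, f => f
  | d, k + 1, f => Uop t y C j d (Zop t y C j (d - 1) k f)

def Mop (x : A) (j : ℤ) (f : Equiv.Perm ℤ → A) (w : Equiv.Perm ℤ) : A :=
  f w + x * Dop j f w

theorem Uop_congr {t y : A} {C j d : ℤ} {f g : Equiv.Perm ℤ → A} {w : Equiv.Perm ℤ}
    (h0 : f w = g w)
    (h : ∀ c, 1 ≤ c → c ≤ C → Cov w d c → f (w * Equiv.swap c d) = g (w * Equiv.swap c d)) :
    Uop t y C j d f w = Uop t y C j d g w := by
  unfold Uop
  rw [h0, Top_congr h]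

theorem pair_up {C : ℤ} {w : Equiv.Perm ℤ} (h : Gd C w) {d j : ℤ} (hd : d ≤ 0) (hw : w d = j)
    (hq : w⁻¹ (j + 1) ≤ 0) : d + 1 ≤ 0 ∧ w (d + 1) = j + 1 := by
  have e := w_winv w (j + 1)
  set q := w⁻¹ (j + 1)
  have hdq : d < q := by
    by_contra hc
    rcases eq_or_lt_of_le (not_lt.mp hc) with h1 | h1
    · rw [h1] at e; omega
    · have := h.lt h1 hd; omega
  have : q = d + 1 := by
    by_contra hc
    have h1 := h.lt (a := d) (b := d + 1) (by omega) (by omega)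
    have h2 := h.lt (a := d + 1) (b := q) (by omega) (by omega)
    omega
  rw [← this]
  exact ⟨hq, e⟩

theorem pair_dn {C : ℤ} {w : Equiv.Perm ℤ} (h : Gd C w) {d j : ℤ} (hd : d ≤ 0) (hw : w d = j + 1)
    (hq : w⁻¹ j ≤ 0) : w (d - 1) = j := by
  have e := w_winv w j
  set q := w⁻¹ j
  have hdq : q < d := by
    by_contra hc
    rcases eq_or_lt_of_le (not_lt.mp hc) with h1 | h1
    · rw [← h1] at e; omega
    · have := h.lt h1 hq; omega
  have : q = d - 1 := by
    by_contra hc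
    have h1 := h.lt (a := d - 1) (b := d) (by omega) (by omega)
    have h2 := h.lt (a := q) (b := d - 1) (by omega) (by omega)
    omega
  rw [← this]
  exact e

theorem Uop_Mop_local {C : ℤ} {w : Equiv.Perm ℤ} (h : Gd C w) {d j : ℤ} (hd : d ≤ 0) (hj : j < C)
    (t x : A) (f : Equiv.Perm ℤ → A)
    (h1 : ¬ (w d = j ∧ w (d + 1) = j + 1 ∧ d + 1 ≤ 0))
    (h2 : ¬ (w d = j + 1 ∧ w (d - 1) = j)) :
    Uop t (t * x) C j d (Mop x j f) w = Mop x j (Uop t (t * x) C (j + 1) d f) w := by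
  have e1 : w d = j ∧ 0 < w⁻¹ (j + 1) ↔ w d = j := by
    refine ⟨fun h => h.1, fun hh => ⟨hh, ?_⟩⟩
    by_contra hc
    have := pair_up h hd hh (by omega)
    exact h1 ⟨hh, this.2, this.1⟩
  have e2 : w d = j + 1 ∧ 0 < w⁻¹ j ↔ w d = j + 1 := by
    refine ⟨fun h => h.1, fun hh => ⟨hh, ?_⟩⟩
    by_contra hc
    exact h2 ⟨hh, pair_dn h hd hh (by omega)⟩
  have e3 : (sT j * w) d = j + 1 ↔ w d = j := by
    rw [Equiv.Perm.mul_apply, sT_app]; split_ifs <;> omega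
  have hM : Top C d (Mop x j f) w = Top C d f w + x * Top C d (Dop j f) w := by
    unfold Mop; rw [Top_add, Top_mul]
  unfold Uop
  rw [hM, comm_TD h hd hj]
  unfold Mop eps
  simp only [e1, e2]
  have hD : Dop j (fun v => (1 - if v d = j + 1 then t * x else 0) * f v + t * Top C d f v) w
      = (1 - if w d = j then t * x else 0) * Dop j f w + t * Dop j (Top C d f) w := by
    unfold Dop
    simp only [e3]
    split_ifs <;> ring
  rw [hD]
  split_ifs <;> first | omega | ring

theorem blocked {C : ℤ} {w : Equiv.Perm ℤ} {d : ℤ} (f : Equiv.Perm ℤ → A)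
    (h : w (d + 1) = w d + 1) (hd : d + 1 ≤ 0) : Top C d f w = 0 := by
  apply Top_zero
  rintro c hc1 hc2 ⟨h1, h2, h3⟩
  exfalso
  have := h3 (d + 1) (by omega) (by omega)
  have hne : w (d + 1) ≠ w c := fun he => by have := w.injective he; omega
  omega

theorem Uop_Mop_two {C : ℤ} {w : Equiv.Perm ℤ} (h : Gd C w) {d j : ℤ} (hd : d ≤ 0) (hj : j < C)
    (t x : A) (f : Equiv.Perm ℤ → A) (h1 : w d = j + 1) (h2 : w (d - 1) = j) :
    Uop t (t * x) C j d (Uop t (t * x) C j (d - 1) (Mop x j f)) w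
      = Mop x j (Uop t (t * x) C (j + 1) d (Uop t (t * x) C (j + 1) (d - 1) f)) w := by
  have p1 : w⁻¹ j = d - 1 := by rw [Equiv.Perm.inv_eq_iff_eq]; exact h2.symm
  have p2 : w⁻¹ (j + 1) = d := by rw [Equiv.Perm.inv_eq_iff_eq]; exact h1.symm
  have hD : ∀ g : Equiv.Perm ℤ → A, Dop j g w = 0 := by
    intro g
    rw [Dop, if_neg (by omega)]
  have hB : ∀ g : Equiv.Perm ℤ → A, Top C (d - 1) g w = 0 := by
    intro g
    exact blocked g (by rw [sub_add_cancel]; omega) (by omega)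
  have hTD : ∀ g : Equiv.Perm ℤ → A, Top C d (Dop j g) w = 0 := by
    intro g
    rw [comm_TD h hd hj, hD, eps, if_neg (by omega), if_neg (by omega)]
    ring
  have hv : ∀ c, 1 ≤ c → (w * Equiv.swap c d) (d - 1) = j := by
    intro c hc
    rw [Equiv.Perm.mul_apply, Equiv.swap_apply_of_ne_of_ne (by omega) (by omega), h2]
  have hg1 : Top C d (Uop t (t * x) C j (d - 1) (Mop x j f)) w =
      Top C d (fun v => (1 - t * x) * (f v + x * Dop j f v) + t * Top C (d - 1) f v
        + t * x * (Dop j (Top C (d - 1) f) v + f v)) w := by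
    apply Top_congr
    intro c hc1 hc2 hcov
    have hg := h.cov hcov hd (by omega) hc2
    unfold Uop
    have hM : Top C (d - 1) (Mop x j f) (w * Equiv.swap c d) = Top C (d - 1) f (w * Equiv.swap c d)
        + x * Top C (d - 1) (Dop j f) (w * Equiv.swap c d) := by
      unfold Mop; rw [Top_add, Top_mul]
    have he : (eps (w * Equiv.swap c d) (d - 1) j : A) = 1 := by
      rw [eps, if_pos, if_neg]
      · ring
      · rw [hv c hc1]; omega
      · refine ⟨hv c hc1, ?_⟩
        rw [inv_swap_app, p2, Equiv.swap_apply_right]; omega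
    rw [if_pos (hv c hc1), hM, comm_TD hg (by omega) hj, he]
    unfold Mop
    ring
  have hg2 : Top C d (Uop t (t * x) C (j + 1) (d - 1) f) w =
      Top C d (fun v => f v + t * Top C (d - 1) f v) w := by
    apply Top_congr
    intro c hc1 hc2 hcov
    unfold Uop
    rw [if_neg (by rw [hv c hc1]; omega)]
    ring
  rw [Mop, hD]
  have uu : ∀ (j' : ℤ) (g : Equiv.Perm ℤ → A), Uop t (t * x) C j' d g w =
      (1 - if w d = j' then t * x else 0) * g w + t * Top C d g w := fun _ _ => rfl
  rw [uu, uu, hg1, hg2]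
  simp only [Top_add, Top_mul, hTD]
  unfold Uop Mop
  rw [if_neg (by omega), if_pos h2, if_pos h1, if_neg (by omega), hB, hB, hD]
  have : Top C d (fun v => t * Top C (d - 1) f v) w = t * Top C d (Top C (d - 1) f) w :=
    Top_mul _ _ _ _ _
  ring

theorem Zop_step {C : ℤ} {j : ℤ} (hj : j < C) (t x : A) (f : Equiv.Perm ℤ → A) (k : ℕ) :
    ∀ (d : ℤ) (w : Equiv.Perm ℤ), Gd C w → d ≤ 0 →
    ¬ (w d = j ∧ w (d + 1) = j + 1 ∧ d + 1 ≤ 0) → w (d - k) ≠ j →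
    Zop t (t * x) C j d k (Mop x j f) w = Mop x j (Zop t (t * x) C (j + 1) d k f) w := by
  induction k using Nat.strong_induction_on with
  | _ k ih =>
  intro d w h hd h1 hb
  match k, ih, hb with
  | 0, _, _ => rfl
  | k + 1, ih, hb =>
    by_cases h2 : w d = j + 1 ∧ w (d - 1) = j
    · match k, ih, hb with
      | 0, _, hb => exact absurd h2.2 (by simpa using hb)
      | k + 1, ih, hb =>
        have hlt := h.lt (a := d - 1 - 1) (b := d - 1) (by omega) (by omega)
        rw [show Zop t (t * x) C j d (k + 1 + 1) (Mop x j f) w =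
          Uop t (t * x) C j d (Uop t (t * x) C j (d - 1)
            (Zop t (t * x) C j (d - 1 - 1) k (Mop x j f))) w from rfl]
        have hval : ∀ (v : Equiv.Perm ℤ) (i c e : ℤ), 0 < c → i < e →  i ≤ 0 →
            (v * Equiv.swap c e) i = v i := by
          intro v i c e hc he hi
          rw [Equiv.Perm.mul_apply, Equiv.swap_apply_of_ne_of_ne (by omega) (by omega)]
        have key : ∀ v, Gd C v → v (d - 1 - 1) = w (d - 1 - 1) →
            v (d - 1 - 1 - k) = w (d - 1 - 1 - k) →
            Zop t (t * x) C j (d - 1 - 1) k (Mop x j f) v =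
              Mop x j (Zop t (t * x) C (j + 1) (d - 1 - 1) k f) v := by
          intro v hv e1 e2
          apply ih k (by omega) _ _ hv (by omega)
          · rw [e1]; omega
          · rw [e2]
            have : d - ((k + 1 + 1 : ℕ) : ℤ) = d - 1 - 1 - k := by push_cast; ring
            rwa [this] at hb
        have key2 : ∀ v, Gd C v → v (d - 1 - 1) = w (d - 1 - 1) →
            v (d - 1 - 1 - k) = w (d - 1 - 1 - k) →
            Uop t (t * x) C j (d - 1) (Zop t (t * x) C j (d - 1 - 1) k (Mop x j f)) v =
            Uop t (t * x) C j (d - 1) (Mop x j (Zop t (t * x) C (j + 1) (d - 1 - 1) k f)) v := by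
          intro v hv e1 e2
          apply Uop_congr (key v hv e1 e2)
          intro c hc1 hc2 hcov
          apply key _ (hv.cov hcov (by omega) (by omega) hc2)
          · rw [hval _ _ _ _ (by omega) (by omega) (by omega), e1]
          · rw [hval _ _ _ _ (by omega) (by omega) (by omega), e2]
        rw [Uop_congr (key2 w h rfl rfl) (g := Uop t (t * x) C j (d - 1)
          (Mop x j (Zop t (t * x) C (j + 1) (d - 1 - 1) k f)))]
        · rw [Uop_Mop_two h hd hj _ _ _ h2.1 h2.2]; rfl
        · intro c hc1 hc2 hcov
          apply key2 _ (h.cov hcov (by omega) (by omega) hc2)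
          · rw [hval _ _ _ _ (by omega) (by omega) (by omega)]
          · rw [hval _ _ _ _ (by omega) (by omega) (by omega)]
    · rw [show Zop t (t * x) C j d (k + 1) (Mop x j f) w =
          Uop t (t * x) C j d (Zop t (t * x) C j (d - 1) k (Mop x j f)) w from rfl]
      have hbb : d - ((k + 1 : ℕ) : ℤ) = d - 1 - k := by push_cast; ring
      rw [hbb] at hb
      rw [Uop_congr (g := Mop x j (Zop t (t * x) C (j + 1) (d - 1) k f))]
      · rw [Uop_Mop_local h hd hj _ _ _ h1 h2]; rfl
      · apply ih k (by omega) _ _ h (by omega) _ hb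
        rw [sub_add_cancel]
        tauto
      · intro c hc1 hc2 hcov
        apply ih k (by omega) _ _ (h.cov hcov (by omega) (by omega) hc2) (by omega)
        · rw [sub_add_cancel]
          rw [Equiv.Perm.mul_apply, Equiv.Perm.mul_apply, Equiv.swap_apply_right,
            Equiv.swap_apply_of_ne_of_ne (by omega) (by omega)]
          have a1 := h.lt (a := d - 1) (b := d) (by omega) hd
          have a2 := hcov.2.1
          omega
        · rw [Equiv.Perm.mul_apply, Equiv.swap_apply_of_ne_of_ne (by omega) (by omega)]
          exact hb

def Lop (x : A) : ℤ → ℕ → (Equiv.Perm ℤ → A) → Equiv.Perm ℤ → A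
  | _, 0, f => f
  | j, k + 1, f => Mop x j (Lop x (j + 1) k f)

def Sop (x : ℕ → A) (B : ℕ) : ℕ → Equiv.Perm ℤ → A
  | 0 => fun w => if w = 1 then 1 else 0
  | n + 1 => Lop (x (n + 1)) (-(B : ℤ)) (B + n + 1) (Sop x B n)

theorem Mop_congr {C N : ℤ} {x : A} {j : ℤ} {f g : Equiv.Perm ℤ → A} {w : Equiv.Perm ℤ}
    (hw : Gd C w) (hlo : ∀ i < N, w i = i) (hj : j < C)
    (h : ∀ v, Gd C v → (∀ i < N, v i = i) → f v = g v) : Mop x j f w = Mop x j g w := by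
  unfold Mop Dop
  rw [h w hw hlo]
  split_ifs with hd
  · rw [h _ (hw.desc hd hj) (lo_desc hlo hd).2]
  · rfl

theorem Lop_congr {C N : ℤ} {x : A} {f g : Equiv.Perm ℤ → A}
    (h : ∀ v, Gd C v → (∀ i < N, v i = i) → f v = g v) (k : ℕ) :
    ∀ (j : ℤ) (w : Equiv.Perm ℤ), Gd C w → (∀ i < N, w i = i) → j + k ≤ C →
      Lop x j k f w = Lop x j k g w := by
  induction k with
  | zero => intro j w hw hlo _; exact h w hw hlo
  | succ k ih =>
    intro j w hw hlo hjk
    push_cast at hjk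
    exact Mop_congr hw hlo (by omega) fun v hv hlv => ih (j + 1) v hv hlv (by omega)

theorem Lop_mul (x a : A) (f : Equiv.Perm ℤ → A) (k : ℕ) :
    ∀ j : ℤ, Lop x j k (fun v => a * f v) = fun v => a * Lop x j k f v := by
  induction k with
  | zero => intro j; rfl
  | succ k ih =>
    intro j
    simp only [Lop]
    rw [ih]
    funext v
    unfold Mop Dop
    split_ifs <;> ring

theorem Lop_tele {C N : ℤ} (t x : A) (f : Equiv.Perm ℤ → A) (K : ℕ) (hK : -(K : ℤ) < N) (k : ℕ) :
    ∀ (j : ℤ) (w : Equiv.Perm ℤ), Gd C w → (∀ i < N, w i = i) → j + k ≤ C → -(K : ℤ) < j →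
      Zop t (t * x) C j 0 K (Lop x j k f) w
        = Lop x j k (Zop t (t * x) C (j + k) 0 K f) w := by
  induction k with
  | zero => intro j w _ _ _ _; simp [Lop]
  | succ k ih =>
    intro j w hw hlo hjk hj
    push_cast at hjk
    simp only [Lop]
    rw [Zop_step (by omega) _ _ _ _ _ _ hw le_rfl (by omega)
      (by rw [hlo _ (by omega)]; omega)]
    apply Mop_congr hw hlo (by omega)
    intro v hv hlv
    rw [ih (j + 1) v hv hlv (by omega) (by omega)]
    congr 2
    push_cast; ring

theorem Uop_zero (t : A) (C j d : ℤ) (f : Equiv.Perm ℤ → A) (w : Equiv.Perm ℤ) :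
    Uop t 0 C j d f w = f w + t * Top C d f w := by
  unfold Uop; simp

theorem Zop_split (t y : A) (C j : ℤ) (f : Equiv.Perm ℤ → A) (k₂ k₁ : ℕ) :
    ∀ d : ℤ, Zop t y C j d (k₁ + k₂) f = Zop t y C j d k₁ (Zop t y C j (d - k₁) k₂ f) := by
  induction k₁ with
  | zero => intro d; simp [Zop]
  | succ k ih =>
    intro d
    rw [show k + 1 + k₂ = (k + k₂) + 1 by ring]
    simp only [Zop]
    rw [ih]
    congr 3
    push_cast; ring

theorem Zop_lin (t : A) (C j : ℤ) (a b : A) (f g : Equiv.Perm ℤ → A) (k : ℕ) :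
    ∀ d : ℤ, Zop t 0 C j d k (fun v => a * f v + b * g v) =
      fun v => a * Zop t 0 C j d k f v + b * Zop t 0 C j d k g v := by
  induction k with
  | zero => intro d; rfl
  | succ k ih =>
    intro d
    simp only [Zop]
    rw [ih]
    funext v
    simp only [Uop_zero]
    rw [Top_add, Top_mul, Top_mul]
    ring

theorem Zop_blocked (t : A) (C j : ℤ) (f : Equiv.Perm ℤ → A) (k : ℕ) :
    ∀ (d : ℤ) (w : Equiv.Perm ℤ), (∀ i ≤ d + 1, w i = i) → d + 1 ≤ 0 →
      Zop t 0 C j d k f w = f w := by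
  induction k with
  | zero => intro d w _ _; rfl
  | succ k ih =>
    intro d w hw hd
    simp only [Zop]
    rw [Uop_zero, blocked _ (by rw [hw _ le_rfl, hw d (by omega)]) hd,
      ih (d - 1) w (fun i hi => hw i (by omega)) (by omega)]
    ring

theorem Zop_pow (t : A) (C j : ℤ) (f : Equiv.Perm ℤ → A) (k : ℕ) :
    ∀ (d : ℤ) (w : Equiv.Perm ℤ), (∀ i ≤ d, w i = i) → d ≤ 0 →
      t ^ k ∣ Zop t 0 C j d k (Top C (d - k) f) w := by
  induction k with
  | zero => intro d w _ _; simp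
  | succ k ih =>
    intro d w hw hd
    have e : d - ((k + 1 : ℕ) : ℤ) = d - 1 - k := by push_cast; ring
    rw [e]
    simp only [Zop]
    rw [Uop_zero, Zop_blocked _ _ _ _ _ _ _ (fun i hi => hw i (by omega)) (by omega),
      blocked _ (by rw [hw _ (by omega), hw _ (by omega)]) (by omega), zero_add, pow_succ']
    apply mul_dvd_mul_left
    unfold Top
    apply Finset.dvd_sum
    intro c hc
    rw [Finset.mem_Icc] at hc
    split_ifs with hcov
    · apply ih _ _ _ (by omega)
      intro i hi
      rw [Equiv.Perm.mul_apply, Equiv.swap_apply_of_ne_of_ne (by omega) (by omega), hw i (by omega)]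
    · exact dvd_zero _

theorem Zop_zero_of {N : ℤ} (t : A) (C j : ℤ) (f : Equiv.Perm ℤ → A) (hN : N ≤ 0)
    (hf : ∀ v : Equiv.Perm ℤ, (∀ i < N, v i = i) → f v = 0) (k : ℕ) :
    ∀ (d : ℤ) (w : Equiv.Perm ℤ), (∀ i < N, w i = i) → N ≤ d - k + 1 →
      Zop t 0 C j d k f w = 0 := by
  induction k with
  | zero => intro d w hw _; exact hf w hw
  | succ k ih =>
    intro d w hw hd
    push_cast at hd
    simp only [Zop]
    rw [Uop_zero, ih (d - 1) w hw (by omega), Top_zero, mul_zero, add_zero]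
    intro c hc1 hc2 hcov
    exact ih (d - 1) _ (lo_swap hw (by omega) (by omega)) (by omega)

theorem Zop_vanish {N : ℤ} (t : A) (C j : ℤ) (f : Equiv.Perm ℤ → A) (hN : N ≤ 0) (K B : ℕ)
    (htK : t ^ K = 0) (hB : K ≤ B + N - 1) (w : Equiv.Perm ℤ) (hw : ∀ i < N, w i = i) :
    Zop t 0 C j 0 B (Top C (-(B : ℤ)) f) w = 0 := by
  obtain ⟨k₁, hk₁⟩ : ∃ k₁ : ℕ, (k₁ : ℤ) = 1 - N := ⟨(1 - N).toNat, by omega⟩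
  obtain ⟨k₂, hk₂⟩ : ∃ k₂ : ℕ, (k₂ : ℤ) = B + N - 1 := ⟨(B + N - 1).toNat, by omega⟩
  have e : B = k₁ + k₂ := by omega
  have e2 : (-(B : ℤ)) = (0 - k₁) - k₂ := by omega
  have e3 : Zop t 0 C j 0 B (Top C (-(B : ℤ)) f) =
      Zop t 0 C j 0 k₁ (Zop t 0 C j (0 - k₁) k₂ (Top C ((0 - k₁) - k₂) f)) := by
    rw [← Zop_split, ← e, e2]
  rw [e3]
  apply Zop_zero_of t C j _ hN _ _ _ _ hw (by omega)
  intro v hv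
  have := Zop_pow t C j f k₂ (0 - k₁) v (fun i hi => hv i (by omega)) (by omega)
  have h0 : t ^ k₂ = 0 := pow_eq_zero_of_le (by omega) htK
  rw [h0] at this
  exact zero_dvd_iff.mp this

theorem Zop_bot (t y : A) (C j' B : ℤ) (f : Equiv.Perm ℤ → A) (k : ℕ) :
    ∀ (d : ℤ) (w : Equiv.Perm ℤ), d - k = B → d ≤ 0 → w B = B →
      Zop t y C B d (k + 1) f w
        = Zop t 0 C j' d k (fun v => (1 - y) * f v + t * Top C B f v) w := by
  induction k with
  | zero =>
    intro d w hd hd0 hw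
    have : d = B := by simpa using hd
    subst this
    simp [Zop, Uop, hw]
  | succ k ih =>
    intro d w hd hd0 hw
    push_cast at hd
    rw [show Zop t y C B d (k+1+1) f w = Uop t y C B d (Zop t y C B (d-1) (k+1) f) w from rfl,
      show Zop t 0 C j' d (k+1) (fun v => (1-y)*f v + t*Top C B f v) w
        = Uop t 0 C j' d (Zop t 0 C j' (d-1) k (fun v => (1-y)*f v + t*Top C B f v)) w from rfl,
      Uop_zero, Uop]
    have : w d ≠ B := fun h => by
      have := w.injective (h.trans hw.symm); omega
    rw [if_neg this, sub_zero, one_mul, ih (d - 1) w (by omega) (by omega) hw]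
    congr 2
    apply Top_congr
    intro c hc1 hc2 hcov
    apply ih (d - 1) _ (by omega) (by omega)
    rw [Equiv.Perm.mul_apply, Equiv.swap_apply_of_ne_of_ne (by omega) (by omega), hw]

theorem Zop_bottom {N : ℤ} (t y : A) (C j' : ℤ) (f : Equiv.Perm ℤ → A) (hN : N ≤ 0) (K B : ℕ)
    (htK : t ^ K = 0) (hB : K ≤ B + N - 1) (w : Equiv.Perm ℤ) (hw : ∀ i < N, w i = i) :
    Zop t y C (-(B : ℤ)) 0 (B + 1) f w = (1 - y) * Zop t 0 C j' 0 (B + 1) f w := by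
  rw [Zop_bot t y C j' (-(B : ℤ)) f B 0 w (by omega) le_rfl (hw _ (by omega)), Zop_lin]
  simp only
  rw [Zop_vanish t C j' f hN K B htK hB w hw, Zop_split]
  have : Zop t 0 C j' (0 - (B : ℤ)) 1 f =
      fun v => 1 * f v + t * Top C (-(B : ℤ)) f v := by
    funext v
    simp only [Zop]
    rw [Uop_zero]; simp
  rw [this, Zop_lin]
  simp only
  rw [Zop_vanish t C j' f hN K B htK hB w hw]
  ring

theorem Zop_top0 (t y : A) (C j a : ℤ) (f : Equiv.Perm ℤ → A)
    (hf : ∀ (u : Equiv.Perm ℤ) (d : ℤ), d ≤ 0 → u d = a → f u = 0) (k : ℕ) :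
    ∀ (d e : ℤ) (u : Equiv.Perm ℤ), d < e → e ≤ 0 → u e = a → Zop t y C j d k f u = 0 := by
  induction k with
  | zero => intro d e u _ he hu; exact hf u e he hu
  | succ k ih =>
    intro d e u hd he hu
    simp only [Zop]
    rw [Uop, ih (d - 1) e u (by omega) he hu, Top_zero]
    · ring
    intro c hc1 hc2 hcov
    apply ih (d - 1) e _ (by omega) he
    rw [Equiv.Perm.mul_apply, Equiv.swap_apply_of_ne_of_ne (by omega) (by omega), hu]

theorem Zop_top (t y : A) (C j' a : ℤ) (f : Equiv.Perm ℤ → A)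
    (hf : ∀ (u : Equiv.Perm ℤ) (d : ℤ), d ≤ 0 → u d = a → f u = 0) (k : ℕ) :
    ∀ (d : ℤ), d ≤ 0 → Zop t y C a d k f = Zop t 0 C j' d k f := by
  induction k with
  | zero => intro d _; rfl
  | succ k ih =>
    intro d hd
    funext u
    simp only [Zop]
    rw [ih (d - 1) (by omega), Uop_zero, Uop]
    split_ifs with h
    · rw [Zop_top0 t 0 C j' a f hf k (d - 1) d u (by omega) hd h]
      ring
    · ring

theorem Lop_supp (x : A) (m : ℤ) (f : Equiv.Perm ℤ → A)
    (hf : ∀ v : Equiv.Perm ℤ, (¬ ∀ i > m, v i = i) → f v = 0) (k : ℕ) :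
    ∀ (j : ℤ) (w : Equiv.Perm ℤ), j + k ≤ m → (¬ ∀ i > m, w i = i) → Lop x j k f w = 0 := by
  induction k with
  | zero => intro j w _ hw; exact hf w hw
  | succ k ih =>
    intro j w hj hw
    push_cast at hj
    simp only [Lop]
    unfold Mop Dop
    rw [ih (j + 1) w (by omega) hw, ih (j + 1) (sT j * w) (by omega)]
    · simp
    · intro h
      apply hw
      intro i hi
      have := h i hi
      rw [Equiv.Perm.mul_apply, sT_app] at this
      split_ifs at this <;> omega

theorem Sop_supp (x : ℕ → A) (B n : ℕ) :
    ∀ v : Equiv.Perm ℤ, (¬ ∀ i > (n : ℤ), v i = i) → Sop x B n v = 0 := by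
  induction n with
  | zero =>
    intro v hv
    simp only [Sop]
    rw [if_neg]
    rintro rfl
    exact hv fun i _ => rfl
  | succ n ih =>
    intro v hv
    simp only [Sop]
    apply Lop_supp _ ((n + 1 : ℕ) : ℤ) _ _ _ _ _ (by push_cast; omega) hv
    intro u hu
    apply ih
    intro h
    exact hu fun i hi => h i (by push_cast at hi; omega)

theorem Zop_delta (t : A) (C j : ℤ) (k : ℕ) :
    ∀ d : ℤ, d ≤ 0 → Zop t 0 C j d k (fun w : Equiv.Perm ℤ => if w = 1 then (1 : A) else 0)
      = fun w : Equiv.Perm ℤ => if w = 1 then (1 : A) else 0 := by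
  induction k with
  | zero => intro d _; rfl
  | succ k ih =>
    intro d hd
    simp only [Zop]
    rw [ih (d - 1) (by omega)]
    funext w
    rw [Uop_zero, Top_zero]
    · ring
    intro c hc1 hc2 hcov
    rw [if_neg]
    intro h
    have h1 := congrArg (fun u : Equiv.Perm ℤ => u d) h
    have h2 := congrArg (fun u : Equiv.Perm ℤ => u c) h
    simp at h1 h2
    have := hcov.2.1
    omega

theorem main_op {N C : ℤ} (x : ℕ → A) (t : A) (hN : N ≤ 0) (K B : ℕ)
    (htK : t ^ K = 0) (hB : K ≤ B + N - 1) (n : ℕ) (hn : (n : ℤ) ≤ C) :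
    ∀ w : Equiv.Perm ℤ, Gd C w → (∀ i < N, w i = i) →
      (∏ i ∈ Finset.range n, (1 - t * x (i + 1))) * Zop t 0 C 0 0 (B + 1) (Sop x B n) w
        = Sop x B n w := by
  induction n with
  | zero =>
    intro w _ _
    simp only [Finset.range_zero, Finset.prod_empty, one_mul, Sop]
    rw [Zop_delta _ _ _ _ _ le_rfl]
  | succ n ih =>
    intro w hw hlo
    push_cast at hn
    rw [Finset.prod_range_succ, mul_assoc]
    rw [← Zop_bottom t (t * x (n + 1)) C 0 (Sop x B (n + 1)) hN K B htK hB w hlo]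
    simp only [Sop]
    rw [Lop_tele t (x (n + 1)) (Sop x B n) (B + 1) (by push_cast; omega) _ _ w hw hlo
      (by push_cast; omega) (by push_cast; omega)]
    rw [show (-(B : ℤ)) + ((B + n + 1 : ℕ) : ℤ) = n + 1 by push_cast; ring]
    rw [Zop_top t (t * x (n + 1)) C 0 (n + 1) (Sop x B n) _ _ _ le_rfl]
    · rw [← congrFun (Lop_mul _ _ _ _ _) w]
      apply Lop_congr (N := N) (C := C) _ _ _ w hw hlo (by push_cast; omega)
      intro v hv hlv
      exact ih (by omega) v hv hlv
    · intro u d hd hu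
      apply Sop_supp
      intro h
      have := h (n + 1) (by omega)
      have := u.injective (this.trans hu.symm)
      omega

/-! ### Schubert polynomials via operators -/

def Red (n : ℤ) : List (ℤ × ℤ) → Equiv.Perm ℤ → Prop
  | [], w => w = 1
  | p :: L, w => w⁻¹ (p.1 + p.2 - n - 1 + 1) < w⁻¹ (p.1 + p.2 - n - 1) ∧
      Red n L (sT (p.1 + p.2 - n - 1) * w)

theorem map_FS (n : ℤ) (L : List (ℤ × ℤ)) :
    FS (L.map fun p => sT (p.1 + p.2 - n - 1)).prod ∧
      len (L.map fun p => sT (p.1 + p.2 - n - 1)).prod ≤ L.length := by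
  have h := prod_FS (L.map fun p => p.1 + p.2 - n - 1)
  rw [List.map_map, List.length_map] at h
  refine ⟨h.1, ?_⟩
  have h1 := len_eq h.1
  exact h1.le.trans h.2

theorem red_iff (n : ℤ) (L : List (ℤ × ℤ)) : ∀ w : Equiv.Perm ℤ,
    ((L.map fun p => sT (p.1 + p.2 - n - 1)).prod = w ∧ len w = L.length) ↔ Red n L w := by
  induction L with
  | nil =>
    intro w
    have := (map_FS n []).2
    simp only [List.map_nil, List.prod_nil, List.length_nil, Red] at this ⊢
    constructor
    · rintro ⟨h, _⟩; exact h.symm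
    · rintro rfl; exact ⟨rfl, by omega⟩
  | cons p L ih =>
    intro w
    simp only [List.map_cons, List.prod_cons, List.length_cons, Red]
    rw [← ih]
    have hP := map_FS n L
    generalize (L.map fun p => sT (p.1 + p.2 - n - 1)).prod = P at *
    generalize p.1 + p.2 - n - 1 = j at *
    constructor
    · rintro ⟨rfl, h⟩
      have hf : FS (sT j * P) := hP.1.swap_mul _ _
      have := len_sT hf j
      rw [sT_sT] at this ⊢
      refine ⟨?_, rfl, ?_⟩ <;> rcases this with ⟨h1, h2⟩ | ⟨h1, h2⟩ <;> first | exact h1 | omega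
    · rintro ⟨h1, h2, h3⟩
      have e : sT j * P = w := by rw [h2, sT_sT]
      refine ⟨e, ?_⟩
      have hf : FS w := by rw [← e]; exact hP.1.swap_mul _ _
      rcases len_sT hf j with ⟨h4, h5⟩ | ⟨h4, h5⟩ <;> omega

def Fop (n : ℤ) : List (ℤ × ℤ) → Equiv.Perm ℤ → MvPolynomial ℕ ℤ
  | [] => fun w => if w = 1 then 1 else 0
  | p :: L => Mop (MvPolynomial.X p.2.toNat) (p.1 + p.2 - n - 1) (Fop n L)

theorem Fop_eq (n : ℤ) (L : List (ℤ × ℤ)) (hL : L.Pairwise fun p q => rcOrder p q ∧ p ≠ q) :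
    ∀ w : Equiv.Perm ℤ, Fop n L w =
      ∑ R ∈ L.toFinset.powerset.filter (fun R => Red n (R.sort rcOrder) w), xR R := by
  induction L with
  | nil =>
    intro w
    simp only [Fop, List.toFinset_nil, Finset.powerset_empty]
    rw [Finset.sum_filter, Finset.sum_singleton]
    simp [Red, xR]
  | cons p L ih =>
    intro w
    rw [List.pairwise_cons] at hL
    have ih := ih hL.2
    have hp : p ∉ L.toFinset := fun h => (hL.1 p (by simpa using h)).2 rfl
    rw [List.toFinset_cons, Finset.sum_filter, Finset.sum_powerset_insert hp, ← Finset.sum_filter,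
      ← ih w]
    simp only [Fop, Mop]
    congr 1
    unfold Dop
    have hs : ∀ R ∈ L.toFinset.powerset, (insert p R).sort rcOrder = p :: R.sort rcOrder ∧
        xR (insert p R) = MvPolynomial.X p.2.toNat * xR R := by
      intro R hR
      rw [Finset.mem_powerset] at hR
      have hpR : p ∉ R := fun h => hp (hR h)
      refine ⟨?_, Finset.prod_insert hpR⟩
      apply Finset.sort_insert
      · intro b hb
        exact (hL.1 b (by simpa using hR hb)).1
      · exact hpR
    rw [Finset.sum_congr rfl (fun R hR => by rw [(hs R hR).1, (hs R hR).2])]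
    split_ifs with hd
    · rw [ih, Finset.sum_filter, Finset.mul_sum]
      apply Finset.sum_congr rfl
      intro R hR
      simp only [Red, hd, true_and]
      split_ifs <;> simp
    · simp only [Red, hd, false_and, if_false, Finset.sum_const_zero, mul_zero]

def rowL (n : ℤ) (k : ℕ) : ℤ → ℕ → List (ℤ × ℤ)
  | _, 0 => []
  | j, c + 1 => (j + n + 1 - k, (k : ℤ)) :: rowL n k (j + 1) c

def boxL (n : ℤ) (B : ℕ) : ℕ → List (ℤ × ℤ)
  | 0 => []
  | k + 1 => rowL n (k + 1) (-(B : ℤ)) (B + k + 1) ++ boxL n B k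

theorem Fop_row (n : ℤ) (k : ℕ) (L : List (ℤ × ℤ)) (c : ℕ) : ∀ j : ℤ,
    Fop n (rowL n k j c ++ L) = Lop (MvPolynomial.X k) j c (Fop n L) := by
  induction c with
  | zero => intro j; rfl
  | succ c ih =>
    intro j
    simp only [rowL, List.cons_append, Fop, Lop]
    rw [ih]
    congr 1
    ring

theorem Fop_box (n : ℤ) (B : ℕ) (k : ℕ) :
    Fop n (boxL n B k) = Sop MvPolynomial.X B k := by
  induction k with
  | zero => rfl
  | succ k ih => simp only [boxL, Sop]; rw [Fop_row, ih]

theorem mem_row (n : ℤ) (k : ℕ) (p : ℤ × ℤ) (c : ℕ) : ∀ j : ℤ,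
    p ∈ rowL n k j c ↔ p.2 = k ∧ j ≤ p.1 + p.2 - n - 1 ∧ p.1 + p.2 - n - 1 < j + c := by
  induction c with
  | zero => intro j; simp [rowL]; omega
  | succ c ih =>
    intro j
    simp only [rowL, List.mem_cons, ih, Prod.ext_iff]
    push_cast
    omega

theorem mem_box (n : ℤ) (B : ℕ) (p : ℤ × ℤ) (k : ℕ) :
    p ∈ boxL n B k ↔ 1 ≤ p.2 ∧ p.2 ≤ k ∧ -(B : ℤ) ≤ p.1 + p.2 - n - 1 ∧ p.1 ≤ n := by
  induction k with
  | zero => simp [boxL]; omega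
  | succ k ih =>
    simp only [boxL, List.mem_append, mem_row, ih]
    push_cast
    omega

theorem row_pw (n : ℤ) (k : ℕ) (c : ℕ) : ∀ j : ℤ,
    (rowL n k j c).Pairwise fun p q => rcOrder p q ∧ p ≠ q := by
  induction c with
  | zero => intro j; exact List.Pairwise.nil
  | succ c ih =>
    intro j
    simp only [rowL, List.pairwise_cons]
    refine ⟨?_, ih _⟩
    intro q hq
    rw [mem_row] at hq
    refine ⟨?_, ?_⟩
    · unfold rcOrder; simp only; omega
    · rintro rfl; simp only at hq; omega

theorem box_pw (n : ℤ) (B : ℕ) (k : ℕ) :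
    (boxL n B k).Pairwise fun p q => rcOrder p q ∧ p ≠ q := by
  induction k with
  | zero => exact List.Pairwise.nil
  | succ k ih =>
    simp only [boxL]
    rw [List.pairwise_append]
    refine ⟨row_pw _ _ _ _, ih, ?_⟩
    intro p hp q hq
    rw [mem_row] at hp
    rw [mem_box] at hq
    push_cast at hp
    refine ⟨?_, ?_⟩
    · unfold rcOrder; omega
    · rintro rfl; omega

theorem red_fix (n : ℤ) (L : List (ℤ × ℤ)) : ∀ w : Equiv.Perm ℤ, Red n L w →
    (∀ p ∈ L, p.1 + p.2 - n - 1 ≤ -1) → ∀ a > 0, w a = a := by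
  induction L with
  | nil => rintro w h _ a _; simp only [Red] at h; rw [h]; rfl
  | cons p L ih =>
    intro w h hL a ha
    have h1 := ih _ h.2 (fun q hq => hL q (List.mem_cons_of_mem _ hq)) a ha
    have h2 := hL p List.mem_cons_self
    have h3 : w = sT (p.1 + p.2 - n - 1) * (sT (p.1 + p.2 - n - 1) * w) := (sT_sT _ _).symm
    rw [h3, Equiv.Perm.mul_apply, h1, sT_app, if_neg (by omega), if_neg (by omega)]

theorem red_mem (n : ℤ) {C N : ℤ} (hC : n ≤ C) (L : List (ℤ × ℤ)) (hs : L.Pairwise rcOrder)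
    (hL : ∀ p ∈ L, p.1 ≤ n ∧ p.2 ≤ n) : ∀ w : Equiv.Perm ℤ, Gd C w → (∀ i < N, w i = i) →
    Red n L w → ∀ p ∈ L, 1 ≤ p.2 ∧ N ≤ p.1 + p.2 - n - 1 := by
  induction L with
  | nil => intro w _ _ _ p hp; simp at hp
  | cons p L ih =>
    intro w hw hlo hr
    rw [List.pairwise_cons] at hs
    have hp := hL p List.mem_cons_self
    have key : 1 ≤ p.2 := by
      by_contra hc
      have hfix := red_fix n (p :: L) w hr (by
        intro q hq
        have hq' := hL q hq
        rcases List.mem_cons.1 hq with rfl | hq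
        · omega
        · have := hs.1 q hq
          unfold rcOrder at this
          omega)
      have hd := hr.1
      have h1 : w⁻¹ (p.1 + p.2 - n - 1) ≤ 0 := by
        by_contra hc2
        have := hfix _ (not_le.1 hc2)
        rw [w_winv] at this
        omega
      have := hw.lt hd h1
      rw [w_winv, w_winv] at this
      omega
    have hl := lo_desc hlo hr.1
    intro q hq
    rcases List.mem_cons.1 hq with rfl | hq
    · exact ⟨key, hl.1⟩
    · exact ih hs.2 (fun q hq => hL q (List.mem_cons_of_mem _ hq)) _
        (hw.desc hr.1 (by omega)) hl.2 hr.2 q hq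

theorem Schub_eq (n : ℕ) {C : ℤ} (hC : (n : ℤ) ≤ C) (B : ℕ) (w : Equiv.Perm ℤ) (hw : Gd C w)
    (hlo : ∀ i < -(B : ℤ), w i = i) : Schub n w = Sop MvPolynomial.X B n w := by
  rw [← Fop_box n B n, Fop_eq _ _ (box_pw _ _ _), Schub, ← finsum_mem_coe_finset]
  have : {R : Finset (ℤ × ℤ) | IsRC n R ∧ wR n R = w} =
      ((boxL n B n).toFinset.powerset.filter (fun R => Red n (R.sort rcOrder) w) :
        Finset (Finset (ℤ × ℤ))) := by
    ext R
    simp only [Set.mem_setOf_eq, Finset.coe_filter, Finset.mem_powerset]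
    have hr := red_iff n (R.sort rcOrder) w
    rw [Finset.length_sort] at hr
    constructor
    · rintro ⟨⟨h1, h2⟩, h3⟩
      have hred := hr.1 ⟨h3, by rw [← h2, h3]⟩
      refine ⟨?_, hred⟩
      intro p hp
      have := red_mem n hC (R.sort rcOrder) (Finset.pairwise_sort _ _)
        (fun p hp => h1 p (by simpa using hp)) w hw hlo hred p (by simpa using hp)
      rw [List.mem_toFinset, mem_box]
      have := h1 p hp
      omega
    · rintro ⟨h1, h2⟩
      have h3 := hr.2 h2
      refine ⟨⟨?_, ?_⟩, h3.1⟩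
      · intro p hp
        have := h1 hp
        rw [List.mem_toFinset, mem_box] at this
        omega
      · have : wR n R = w := h3.1
        rw [this]; exact h3.2
  rw [this]

/-! ### Chains -/

def sw (q : ℤ × ℤ) : Equiv.Perm ℤ := Equiv.swap q.1 q.2

def ChL : ℤ → Equiv.Perm ℤ → List (ℤ × ℤ) → Prop
  | _, _, [] => True
  | d, w, q :: l => 0 < q.1 ∧ q.2 ≤ d ∧ Cov w q.2 q.1 ∧ ChL (q.2 - 1) (w * sw q) l

theorem ChL_iff (l : List (ℤ × ℤ)) : ∀ (d : ℤ) (w : Equiv.Perm ℤ), d ≤ 0 → FS w →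
    (((∀ q ∈ l, 0 < q.1 ∧ q.2 ≤ d) ∧ l.Pairwise (fun a b => b.2 < a.2) ∧
      ∀ m' ≤ l.length, len (w * ((l.map sw).take m').prod) = len w + m') ↔ ChL d w l) := by
  induction l with
  | nil => intro d w _ _; simp [ChL]
  | cons q l ih =>
    intro d w hd hf
    have hf' : FS (w * sw q) := hf.mul_swap _ _
    simp only [ChL]
    constructor
    · rintro ⟨h1, h2, h3⟩
      rw [List.pairwise_cons] at h2
      have hq := h1 q List.mem_cons_self
      have h31 := h3 1 (by simp)
      simp only [List.map_cons, List.take_succ_cons, List.take_zero, List.prod_cons, List.prod_nil,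
        mul_one] at h31
      have hc := (len_cov hf (d := q.2) (c := q.1) (by omega)).1 h31
      refine ⟨hq.1, hq.2, hc, (ih (q.2 - 1) _ (by omega) hf').1 ⟨?_, h2.2, ?_⟩⟩
      · intro r hr
        have := h1 r (List.mem_cons_of_mem _ hr)
        have := h2.1 r hr
        omega
      · intro m' hm'
        have := h3 (m' + 1) (by simpa using hm')
        rw [List.map_cons, List.take_succ_cons, List.prod_cons, ← mul_assoc] at this
        omega
    · rintro ⟨h1, h2, h3, h4⟩
      obtain ⟨h5, h6, h7⟩ := (ih (q.2 - 1) _ (by omega) hf').2 h4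
      have hc := (len_cov hf h3.1).2 h3
      change len (w * sw q) = _ at hc
      refine ⟨?_, ?_, ?_⟩
      · intro r hr
        rcases List.mem_cons.1 hr with rfl | hr
        · exact ⟨h1, h2⟩
        · have := h5 r hr
          omega
      · rw [List.pairwise_cons]
        refine ⟨fun r hr => ?_, h6⟩
        have := h5 r hr
        omega
      · intro m' hm'
        cases m' with
        | zero => simp
        | succ m' =>
          have := h7 m' (by simpa using hm')
          rw [List.map_cons, List.take_succ_cons, List.prod_cons, ← mul_assoc]
          omega

theorem ChL_bounds (l : List (ℤ × ℤ)) : ∀ (d : ℤ) (w : Equiv.Perm ℤ) (D N : ℤ), d ≤ 0 → 0 ≤ D →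
    N ≤ 0 → Gd D w → (∀ i < N, w i = i) → ChL d w l →
    (∀ q ∈ l, q.1 ≤ D + l.length ∧ N - l.length ≤ q.2) ∧
    Gd (D + l.length) (w * (l.map sw).prod) ∧
    (∀ i < N - l.length, (w * (l.map sw).prod) i = i) := by
  induction l with
  | nil => intro d w D N _ _ _ hw hlo _; simp [hw]; exact hlo
  | cons q l ih =>
    intro d w D N hd hD hN hw hlo ⟨h1, h2, h3, h4⟩
    have hc : q.1 ≤ D + 1 := by
      by_contra hc
      have e1 := hw.hi q.1 (by omega)
      have e2 := hw.hi (q.1 - 1) (by omega)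
      obtain ⟨_, h5, h6⟩ := h3
      have h6 := h6 (q.1 - 1) (by omega) (by omega)
      have hne : w q.2 ≠ w (q.1 - 1) := fun h => by have := w.injective h; omega
      omega
    have he : N - 1 ≤ q.2 := by
      by_contra hc
      have e1 := hlo q.2 (by omega)
      have e2 := hlo (q.2 + 1) (by omega)
      obtain ⟨_, h5, h6⟩ := h3
      have h6 := h6 (q.2 + 1) (by omega) (by omega)
      have hne : w q.1 ≠ w (q.2 + 1) := fun h => by have := w.injective h; omega
      omega
    have hw' : Gd (D + 1) w := ⟨hw.mono, fun i hi => hw.hi i (by omega)⟩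
    have := ih (q.2 - 1) (w * sw q) (D + 1) (N - 1) (by omega) (by omega) (by omega)
      (hw'.cov h3 (by omega) h1 hc) (lo_swap (fun i hi => hlo i (by omega)) he (by omega)) h4
    obtain ⟨g1, g2, g3⟩ := this
    rw [List.map_cons, List.prod_cons, ← mul_assoc, List.length_cons]
    push_cast
    refine ⟨?_, ?_, ?_⟩
    · intro r hr
      rcases List.mem_cons.1 hr with rfl | hr
      · omega
      · have := g1 r hr
        omega
    · rwa [show D + ((l.length : ℤ) + 1) = D + 1 + l.length by ring]
    · rwa [show N - ((l.length : ℤ) + 1) = N - 1 - l.length by ring]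

def CF (C : ℤ) : ℕ → ℕ → ℤ → Equiv.Perm ℤ → Finset (List (ℤ × ℤ))
  | 0, 0, _, _ => {[]}
  | _ + 1, 0, _, _ => ∅
  | 0, _ + 1, _, _ => {[]}
  | m + 1, k + 1, d, w => CF C (m + 1) k (d - 1) w ∪
      ((Finset.Icc 1 C).filter (fun c => Cov w d c)).biUnion
        fun c => (CF C m k (d - 1) (w * Equiv.swap c d)).image (List.cons (c, d))

def Ch (C : ℤ) (f : Equiv.Perm ℤ → A) : ℕ → ℕ → ℤ → Equiv.Perm ℤ → A
  | 0, 0, _, w => f w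
  | _ + 1, 0, _, _ => 0
  | 0, _ + 1, _, w => f w
  | m + 1, k + 1, d, w => Ch C f (m + 1) k (d - 1) w + Top C d (Ch C f m k (d - 1)) w

theorem mem_CF (C : ℤ) (k : ℕ) : ∀ (m : ℕ) (d : ℤ) (w : Equiv.Perm ℤ) (l : List (ℤ × ℤ)),
    l ∈ CF C m k d w ↔ l.length = m ∧ ChL d w l ∧ ∀ q ∈ l, q.1 ≤ C ∧ d - k < q.2 := by
  induction k with
  | zero =>
    intro m d w l
    cases m with
    | zero =>
      simp only [CF, Finset.mem_singleton, List.length_eq_zero_iff]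
      constructor
      · rintro rfl; simp [ChL]
      · exact fun h => h.1
    | succ m =>
      simp only [CF, Finset.notMem_empty, false_iff]
      rintro ⟨h1, h2, h3⟩
      cases l with
      | nil => simp at h1
      | cons q l =>
        have := h3 q List.mem_cons_self
        have := h2.2.1
        omega
  | succ k ih =>
    intro m d w l
    cases m with
    | zero =>
      simp only [CF, Finset.mem_singleton, List.length_eq_zero_iff]
      constructor
      · rintro rfl; simp [ChL]
      · exact fun h => h.1
    | succ m =>
      simp only [CF, Finset.mem_union, Finset.mem_biUnion, Finset.mem_filter, Finset.mem_Icc,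
        Finset.mem_image, ih]
      push_cast
      constructor
      · rintro (⟨h1, h2, h3⟩ | ⟨c, ⟨hc, hcov⟩, l', ⟨h1, h2, h3⟩, rfl⟩)
        · cases l with
          | nil => simp at h1
          | cons q l =>
            refine ⟨h1, ⟨h2.1, ?_, h2.2.2⟩, fun q hq => ?_⟩
            · have := h2.2.1
              omega
            · have := h3 q hq
              omega
        · refine ⟨by simp [h1], ⟨by simp only; omega, le_rfl, hcov, h2⟩, fun q hq => ?_⟩
          rcases List.mem_cons.1 hq with rfl | hq
          · simp only; omega
          · have := h3 q hq
            omega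
      · rintro ⟨h1, h2, h3⟩
        cases l with
        | nil => simp at h1
        | cons q l =>
          obtain ⟨g1, g2, g3, g4⟩ := h2
          by_cases hq : q.2 = d
          · right
            have h3q := h3 q List.mem_cons_self
            obtain ⟨c, e⟩ := q
            simp only at hq
            subst hq
            refine ⟨c, ⟨⟨g1, h3q.1⟩, g3⟩, l, ⟨by simpa using h1, g4, fun r hr => ?_⟩, rfl⟩
            have := h3 r (List.mem_cons_of_mem _ hr)
            omega
          · left
            refine ⟨h1, ⟨g1, by omega, g3, g4⟩, fun r hr => ?_⟩
            have := h3 r hr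
            omega

theorem Ch_eq (C : ℤ) (f : Equiv.Perm ℤ → A) (k : ℕ) : ∀ (m : ℕ) (d : ℤ) (w : Equiv.Perm ℤ),
    Ch C f m k d w = ∑ l ∈ CF C m k d w, f (w * (l.map sw).prod) := by
  induction k with
  | zero => intro m d w; cases m <;> simp [Ch, CF]
  | succ k ih =>
    intro m d w
    cases m with
    | zero => simp [Ch, CF]
    | succ m =>
      simp only [Ch, CF]
      rw [Finset.sum_union, ih, Finset.sum_biUnion]
      · congr 1
        unfold Top
        rw [Finset.sum_filter]
        apply Finset.sum_congr rfl
        intro c _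
        split_ifs
        · rw [ih, Finset.sum_image (fun a _ b _ h => List.cons_injective h)]
          apply Finset.sum_congr rfl
          intro l _
          rw [List.map_cons, List.prod_cons, ← mul_assoc]
          rfl
        · rfl
      · intro c _ c' _ hne
        rw [Function.onFun, Finset.disjoint_left]
        intro l hl hl'
        rw [Finset.mem_image] at hl hl'
        obtain ⟨a, _, rfl⟩ := hl
        obtain ⟨b, _, hb⟩ := hl'
        simp only [List.cons.injEq, Prod.mk.injEq] at hb
        exact hne hb.1.1.symm
      · rw [Finset.disjoint_left]
        intro l hl hl'
        rw [mem_CF] at hl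
        simp only [Finset.mem_biUnion, Finset.mem_image] at hl'
        obtain ⟨c, _, a, _, rfl⟩ := hl'
        have := hl.2.1.2.1
        simp only at this
        omega

open PowerSeries in
theorem coeff_Zop (C : ℤ) (f : Equiv.Perm ℤ → A) (k : ℕ) :
    ∀ (m : ℕ) (d : ℤ) (w : Equiv.Perm ℤ),
    coeff m (Zop (X : A⟦X⟧) 0 C 0 d k (fun v => PowerSeries.C (f v)) w) = Ch C f m k d w := by
  induction k with
  | zero => intro m d w; cases m <;> simp [Zop, Ch, coeff_C]
  | succ k ih =>
    intro m d w
    simp only [Zop]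
    rw [Uop_zero]
    cases m with
    | zero =>
      rw [map_add, ih, coeff_zero_X_mul, add_zero]
      cases k <;> rfl
    | succ m =>
      rw [map_add, ih, coeff_succ_X_mul]
      simp only [Ch]
      congr 1
      unfold Top
      rw [map_sum]
      apply Finset.sum_congr rfl
      intro c _
      split_ifs
      · rw [ih]
      · simp

theorem Zop_map {A' : Type*} [CommRing A'] (φ : A →+* A') (t y : A) (C j : ℤ)
    (f : Equiv.Perm ℤ → A) (k : ℕ) : ∀ (d : ℤ) (w : Equiv.Perm ℤ),
    φ (Zop t y C j d k f w) = Zop (φ t) (φ y) C j d k (fun v => φ (f v)) w := by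
  induction k with
  | zero => intro d w; rfl
  | succ k ih =>
    intro d w
    simp only [Zop, Uop, Top, map_add, map_mul, map_sub, map_sum, map_one, ← ih]
    congr 2
    · split_ifs <;> simp
    · apply Finset.sum_congr rfl
      intro c _
      split_ifs <;> simp

theorem Lop_map {A' : Type*} [CommRing A'] (φ : A →+* A') (x : A)
    (f : Equiv.Perm ℤ → A) (k : ℕ) : ∀ (j : ℤ) (w : Equiv.Perm ℤ),
    φ (Lop x j k f w) = Lop (φ x) j k (fun v => φ (f v)) w := by
  induction k with
  | zero => intro d w; rfl
  | succ k ih =>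
    intro d w
    simp only [Lop, Mop, Dop, map_add, map_mul, ← ih]
    split_ifs <;> simp

theorem Sop_map {A' : Type*} [CommRing A'] (φ : A →+* A') (x : ℕ → A) (B n : ℕ) :
    ∀ (w : Equiv.Perm ℤ), φ (Sop x B n w) = Sop (fun i => φ (x i)) B n w := by
  induction n with
  | zero => intro w; simp only [Sop]; split_ifs <;> simp
  | succ n ih =>
    intro w
    simp only [Sop]
    rw [Lop_map]
    congr 1
    funext v
    exact ih v

/-! ### Complete homogeneous polynomials -/

theorem hPoly_zero_right (n : ℕ) : hPoly n 0 = 1 := by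
  unfold hPoly
  rw [Finset.sym_zero, Finset.sum_singleton]
  exact (congrArg Multiset.prod (Multiset.map_zero _)).trans Multiset.prod_zero

theorem hPoly_zero_left (m : ℕ) : hPoly 0 (m + 1) = 0 := by
  unfold hPoly
  simp

theorem hPoly_succ (n m : ℕ) :
    hPoly (n + 1) (m + 1) = hPoly n (m + 1) + MvPolynomial.X (n + 1) * hPoly (n + 1) m := by
  unfold hPoly
  rw [← Finset.sum_filter_add_sum_filter_not _ (fun s : Sym ℕ (m + 1) => (n + 1) ∈ s), add_comm]
  congr 1
  · apply Finset.sum_congr _ (fun _ _ => rfl)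
    ext s
    simp only [Finset.mem_filter, Finset.mem_sym_iff, Finset.mem_Icc]
    constructor
    · rintro ⟨h1, h2⟩ a ha
      have := h1 a ha
      have : a ≠ n + 1 := by rintro rfl; exact h2 ha
      omega
    · intro h
      refine ⟨fun a ha => ?_, fun hc => ?_⟩
      · have := h a ha
        omega
      · have := h _ hc
        omega
  · have : ((Finset.Icc 1 (n + 1)).sym (m + 1)).filter (fun s : Sym ℕ (m + 1) => (n + 1) ∈ s) =
        ((Finset.Icc 1 (n + 1)).sym m).image (Sym.cons (n + 1)) := by
      ext s
      simp only [Finset.mem_filter, Finset.mem_image, Finset.mem_sym_iff]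
      constructor
      · rintro ⟨h1, h2⟩
        obtain ⟨s', rfl⟩ := (⟨s.erase (n + 1) h2, (Sym.cons_erase h2).symm⟩ :
          ∃ s' : Sym ℕ m, s = Sym.cons (n + 1) s')
        exact ⟨s', fun a ha => h1 a (Sym.mem_cons_of_mem ha), rfl⟩
      · rintro ⟨s', h1, rfl⟩
        refine ⟨fun a ha => ?_, Sym.mem_cons_self _ _⟩
        rcases Sym.mem_cons.1 ha with rfl | ha
        · simp
        · exact h1 a ha
    rw [this, Finset.sum_image (fun a _ b _ h => by simpa using h), Finset.mul_sum]
    apply Finset.sum_congr rfl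
    intro s _
    exact (congrArg Multiset.prod (Multiset.map_cons _ _ _)).trans (Multiset.prod_cons _ _)

open PowerSeries in
theorem h_gen (n : ℕ) :
    (∏ i ∈ Finset.range n, (1 - (X : (MvPolynomial ℕ ℤ)⟦X⟧) * PowerSeries.C (MvPolynomial.X (i + 1))))
      * PowerSeries.mk (hPoly n) = 1 := by
  induction n with
  | zero =>
    ext1 m
    cases m with
    | zero => simp [hPoly_zero_right]
    | succ m => simp [hPoly_zero_left, coeff_one]
  | succ n ih =>
    rw [Finset.prod_range_succ, mul_assoc]
    rw [show (1 - (X : (MvPolynomial ℕ ℤ)⟦X⟧) * PowerSeries.C (MvPolynomial.X (n + 1)))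
      * PowerSeries.mk (hPoly (n + 1)) = PowerSeries.mk (hPoly n) from ?_, ih]
    ext1 m
    rw [sub_mul, one_mul, map_sub, mul_assoc]
    cases m with
    | zero => simp [hPoly_zero_right]
    | succ m => rw [coeff_succ_X_mul, coeff_C_mul, coeff_mk, coeff_mk, coeff_mk, hPoly_succ]; ring

open PowerSeries in
theorem Pieri_op (n m : ℕ) {N : ℤ} (hN : N ≤ 0) (B : ℕ) (hB : (m + 1 : ℕ) ≤ B + N - 1)
    (w : Equiv.Perm ℤ) (hw : Gd (n + m : ℕ) w) (hlo : ∀ i < N, w i = i) :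
    Ch (n + m : ℕ) (Sop MvPolynomial.X B n) m (B + 1) 0 w
      = Sop MvPolynomial.X B n w * hPoly n m := by
  let I : Ideal (MvPolynomial ℕ ℤ)⟦X⟧ := Ideal.span {X ^ (m + 1)}
  let φ := Ideal.Quotient.mk I
  have ht : (φ X) ^ (m + 1) = 0 := by
    rw [← map_pow]
    exact Ideal.Quotient.eq_zero_iff_mem.2 (Ideal.subset_span rfl)
  have key := main_op (fun i => φ (PowerSeries.C (MvPolynomial.X i))) (φ X) hN (m + 1) B ht hB n
    (C := (n + m : ℕ)) (by push_cast; omega) w hw hlo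
  have e1 : Sop (fun i => φ (PowerSeries.C (MvPolynomial.X i))) B n
      = fun v => φ (PowerSeries.C (Sop MvPolynomial.X B n v)) := by
    funext v
    exact (Sop_map (φ.comp PowerSeries.C) MvPolynomial.X B n v).symm
  rw [e1] at key
  have e2 := Zop_map φ X 0 (n + m : ℕ) 0 (fun v => PowerSeries.C (Sop MvPolynomial.X B n v)) (B + 1) 0 w
  rw [map_zero] at e2
  rw [← e2] at key
  have e3 : (∏ i ∈ Finset.range n, (1 - φ X * φ (PowerSeries.C (MvPolynomial.X (i + 1))))) =
    φ (∏ i ∈ Finset.range n, (1 - (X : (MvPolynomial ℕ ℤ)⟦X⟧) * PowerSeries.C (MvPolynomial.X (i + 1)))) := by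
    simp
  rw [e3, ← map_mul] at key
  have key2 := congrArg (fun z => φ (PowerSeries.mk (hPoly n)) * z) key
  simp only [← map_mul] at key2
  rw [← mul_assoc, mul_comm (PowerSeries.mk (hPoly n)), h_gen, one_mul] at key2
  rw [Ideal.Quotient.eq, Ideal.mem_span_singleton, X_pow_dvd_iff] at key2
  have := key2 m (Nat.lt_succ_self m)
  rw [map_sub, coeff_Zop, coeff_mul_C, coeff_mk, sub_eq_zero] at this
  rw [this, mul_comm]

theorem Pieri_set (n m : ℕ) (w : Equiv.Perm ℤ) (hf : FS w) {N : ℤ} (hN : N ≤ 0) (B : ℕ)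
    (hB : (m + 1 : ℕ) ≤ B + N - 1) (hw : Gd n w) (hlo : ∀ i < N, w i = i) :
    (∑ᶠ p ∈ {p : Fin m → ℤ × ℤ |
          (∀ i, 0 < (p i).1 ∧ (p i).2 ≤ 0) ∧
          (∀ i j : Fin m, i < j → (p j).2 < (p i).2) ∧
          (∀ m' : ℕ, m' ≤ m →
            len (w * ((List.ofFn fun i : Fin m => Equiv.swap (p i).1 (p i).2).take m').prod)
              = len w + m')},
        Schub n (w * (List.ofFn fun i : Fin m => Equiv.swap (p i).1 (p i).2).prod)) =
    ∑ l ∈ CF (n + m : ℕ) m (B + 1) 0 w, Schub n (w * (l.map sw).prod) := by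
  rw [← finsum_mem_coe_finset]
  have hmap : ∀ p : Fin m → ℤ × ℤ, (List.ofFn fun i : Fin m => Equiv.swap (p i).1 (p i).2)
      = (List.ofFn p).map sw := by
    intro p
    rw [List.map_ofFn]; rfl
  have hiff : ∀ p : Fin m → ℤ × ℤ, ((∀ i, 0 < (p i).1 ∧ (p i).2 ≤ 0) ∧
          (∀ i j : Fin m, i < j → (p j).2 < (p i).2) ∧
          (∀ m' : ℕ, m' ≤ m →
            len (w * ((List.ofFn fun i : Fin m => Equiv.swap (p i).1 (p i).2).take m').prod)
              = len w + m')) ↔ ChL 0 w (List.ofFn p) := by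
    intro p
    rw [← ChL_iff (List.ofFn p) 0 w le_rfl hf, List.forall_mem_ofFn_iff, List.pairwise_ofFn,
      List.length_ofFn, hmap]
  refine finsum_mem_eq_of_bijOn List.ofFn ⟨?_, List.ofFn_injective.injOn, ?_⟩ ?_
  · intro p hp
    have hc := (hiff p).1 hp
    have hb := (ChL_bounds _ 0 w n N le_rfl (by omega) hN hw hlo hc).1
    rw [Finset.mem_coe, mem_CF]
    refine ⟨List.length_ofFn, hc, fun q hq => ?_⟩
    have := hb q hq
    rw [List.length_ofFn] at this
    push_cast
    omega
  · intro l hl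
    rw [Finset.mem_coe, mem_CF] at hl
    obtain ⟨h1, h2, -⟩ := hl
    have : ∃ p : Fin m → ℤ × ℤ, List.ofFn p = l := by
      subst h1
      exact ⟨l.get, List.ofFn_get l⟩
    obtain ⟨p, rfl⟩ := this
    exact ⟨p, (hiff p).2 h2, rfl⟩
  · intro p _
    rw [hmap]

theorem main_final (n : ℕ) (w : Equiv.Perm ℤ) (hwperm : IsPermZ n w)
    (hw : ∀ i : ℤ, i ≤ 0 → w (i - 1) < w i) (m : ℕ) :
    Schub n w * hPoly n m =
      ∑ᶠ p ∈ {p : Fin m → ℤ × ℤ |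
          (∀ i, 0 < (p i).1 ∧ (p i).2 ≤ 0) ∧
          (∀ i j : Fin m, i < j → (p j).2 < (p i).2) ∧
          (∀ m' : ℕ, m' ≤ m →
            len (w * ((List.ofFn fun i : Fin m => Equiv.swap (p i).1 (p i).2).take m').prod)
              = len w + m')},
        Schub n (w * (List.ofFn fun i : Fin m => Equiv.swap (p i).1 (p i).2).prod) := by
  obtain ⟨hhi, N', hlo'⟩ := hwperm
  obtain ⟨N, hN, hlo⟩ : ∃ N : ℤ, N ≤ 0 ∧ ∀ i < N, w i = i :=
    ⟨min N' 0, min_le_right _ _, fun i hi => hlo' i (by omega)⟩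
  have hf : FS w := ⟨N, n, fun i hi => hi.elim (hlo i) (hhi i)⟩
  have hg : Gd n w := ⟨hw, hhi⟩
  have hg' : Gd (n + m : ℕ) w := ⟨hw, fun i hi => hhi i (by push_cast at hi; omega)⟩
  obtain ⟨B, hB⟩ : ∃ B : ℕ, (m + 1 : ℕ) ≤ B + N - 1 := ⟨(m + 2 - N).toNat, by push_cast; omega⟩
  rw [Pieri_set n m w hf hN B hB hg hlo, Schub_eq n le_rfl B w hg (fun i hi => hlo i (by omega)),
    ← Pieri_op n m hN B hB w hg' hlo, Ch_eq]
  apply Finset.sum_congr rfl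
  intro l hl
  rw [mem_CF] at hl
  obtain ⟨h1, h2, -⟩ := hl
  obtain ⟨-, b2, b3⟩ := ChL_bounds _ 0 w n N le_rfl (by omega) hN hg hlo h2
  rw [h1] at b2 b3
  exact (Schub_eq n (by omega) B _ b2 (fun i hi => b3 i (by push_cast at hB; omega))).symm
/-- a special case of Pieri's formula.  For a permutation `w` with
`w(i) > w(i−1)` for all `i ≤ 0` and `m ≥ 1`,
`S_w · h_m = Σ S_{w·s_{c₁,d₁}⋯s_{c_m,d_m}}`, the sum being over all sequences of pairs
`(cᵢ,dᵢ)` with `cᵢ > 0 ≥ dᵢ`, `d₁ > d₂ > … > d_m`, and all partial products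
length-additive. -/
theorem schubert_mul_h (n : ℕ) (hn : 0 < n) (w : Equiv.Perm ℤ) (hwperm : IsPermZ n w)
    (hw : ∀ i : ℤ, i ≤ 0 → w (i - 1) < w i) (m : ℕ) (hm : 1 ≤ m) :
    Schub n w * hPoly n m =
      ∑ᶠ p ∈ {p : Fin m → ℤ × ℤ |
          (∀ i, 0 < (p i).1 ∧ (p i).2 ≤ 0) ∧
          (∀ i j : Fin m, i < j → (p j).2 < (p i).2) ∧
          (∀ m' : ℕ, m' ≤ m →
            len (w * ((List.ofFn fun i : Fin m => Equiv.swap (p i).1 (p i).2).take m').prod)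
              = len w + m')},
        Schub n (w * (List.ofFn fun i : Fin m => Equiv.swap (p i).1 (p i).2).prod) := by
  exact main_final n w hwperm hw m

end RCGraphs
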